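/- Fix an integer r ≥ 2. For every n ∈ ℤ, the element x_n of ℚ(x_1,x_2) is a Laurent polynomial in x_1 and x_2 with nonnegative integer coefficients; that is, x_n lies in the subring ℤ[x_1^{±1}, x_2^{±1}] and, when written in the ℤ-basis of monomials x_1^{a} x_2^{b} (a, b ∈ ℤ), all of its coefficients are nonnegative. -/

import Mathlib

open scoped Classical

namespace CF

noncomputable section

/-- The sequence `c` : `c 1 = 0`, `c 2 = 1`, `c n = r * c (n-1) - c (n-2)`.
(The value `c 0 = -1` is the unique value consistent with the recurrence.) -/
def c (r : ℕ) : ℕ → ℤ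
  | 0 => -1
  | 1 => 0
  | n + 2 => (r : ℤ) * c r (n + 1) - c r n

/-- `c` as a natural number (valid for indices `≥ 1` when `r ≥ 2`). -/
def cN (r n : ℕ) : ℕ := (c r n).toNat

/-- Height (y-coordinate) of the vertex `w_k` of the maximal Dyck path `D_n`:
the maximal Dyck path from `(0,0)` to `(c_{n-1}-c_{n-2}, c_{n-2})` weakly below the
diagonal has `w_k = (k - ⌊k·c_{n-2}/c_{n-1}⌋, ⌊k·c_{n-2}/c_{n-1}⌋)`. -/
def hgt (r n k : ℕ) : ℕ := k * cN r (n - 2) / cN r (n - 1)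

/-- The edge `α_j` of `D_n` is vertical (a north step). -/
def isVert (r n j : ℕ) : Prop := hgt r n (j - 1) < hgt r n j

/-- Index in the vertex sequence `w_0, …, w_{c_{n-1}}` of the vertex `v_j`
(the upper endpoint of the `j`-th vertical edge); `vpos r n 0 = 0`. -/
def vpos (r n j : ℕ) : ℕ := (j * cN r (n - 1) + cN r (n - 2) - 1) / cN r (n - 2)

/-- x-coordinate of the vertex `v_j` of `D_n` (its y-coordinate is `j`). -/
def vx (r n j : ℕ) : ℤ := (vpos r n j : ℤ) - (j : ℤ)

/-- The slope `s_{i,t}` between `v_i` and `v_t` is at most the slope `s` of the diagonal,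
expressed by cross-multiplication. -/
def slopeLE (r n i t : ℕ) : Prop :=
  ((t : ℤ) - (i : ℤ)) * (c r (n - 1) - c r (n - 2)) ≤ (vx r n t - vx r n i) * c r (n - 2)

/-- `{t | i < t ≤ k, s_{i,t} > s}`. -/
def badSet (r n i k : ℕ) : Finset ℕ :=
  (Finset.Icc (i + 1) k).filter fun t => ¬ slopeLE r n i t

/-- `α(i,k)` is blue: `s_{i,t} ≤ s` for all `i < t ≤ k`. -/
def isBlue (r n i k : ℕ) : Prop := badSet r n i k = ∅

/-- `t₀` is the minimum of `{t | i < t ≤ k, s_{i,t} > s}`. -/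
def minBad (r n i k t₀ : ℕ) : Prop :=
  t₀ ∈ badSet r n i k ∧ ∀ t ∈ badSet r n i k, t₀ ≤ t

/-- `α(i,k)` is `(m,w)`-green: the minimum `t₀` of `{t | i < t ≤ k, s_{i,t} > s}` exists and
equals `i + c_m - w·c_{m-1}`, with `3 ≤ m ≤ n-2` and `1 ≤ w < r-1`. -/
def isGreenMW (r n i k m w : ℕ) : Prop :=
  3 ≤ m ∧ m + 2 ≤ n ∧ 1 ≤ w ∧ (w : ℤ) < (r : ℤ) - 1 ∧
    ∃ t₀ : ℕ, minBad r n i k t₀ ∧ (t₀ : ℤ) = (i : ℤ) + (c r m - (w : ℤ) * c r (m - 1))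

def isGreen (r n i k : ℕ) : Prop := ∃ m w, isGreenMW r n i k m w

/-- `α(i,k)` is red: neither blue nor green. -/
def isRed (r n i k : ℕ) : Prop := ¬ isBlue r n i k ∧ ¬ isGreen r n i k

/-- An element of `P(D_n)`: either a single edge `α_j` (`Sum.inl j`) or a subpath
`α(i,k)` (`Sum.inr (i,k)`). -/
abbrev Elt := ℕ ⊕ ℕ × ℕ

/-- The set of (indices of) edges of `D_n` constituting an element of `P(D_n)`:
a single edge; for `α(i,k)`, the edges from `v_i` (or from its immediate predecessor,
in the red case) to `v_k`. -/
def edges (r n : ℕ) : Elt → Finset ℕ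
  | Sum.inl j => {j}
  | Sum.inr (i, k) =>
      if isRed r n i k then Finset.Icc (vpos r n i) (vpos r n k)
      else Finset.Icc (vpos r n i + 1) (vpos r n k)

/-- Validity of an element of `P(D_n)`: `1 ≤ j ≤ c_{n-1}` for a single edge,
`0 ≤ i < k ≤ c_{n-2}` for a subpath `α(i,k)`. -/
def validElt (r n : ℕ) : Elt → Prop
  | Sum.inl j => 1 ≤ j ∧ (j : ℤ) ≤ c r (n - 1)
  | Sum.inr (i, k) => i < k ∧ (k : ℤ) ≤ c r (n - 2)

/-- The common conditions on a collection `β = {β_1,…,β_t}` of elements of `P(D_n)`: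
all elements are valid, distinct elements share no edge, and for any two subpaths
`α(i,k)`, `α(i',k')` one has `i ≠ k'` and `i' ≠ k`. -/
def validColl (r n : ℕ) (β : Finset Elt) : Prop :=
  (∀ p ∈ β, validElt r n p) ∧
  (∀ p ∈ β, ∀ q ∈ β, p ≠ q → Disjoint (edges r n p) (edges r n q)) ∧
  (∀ i k i' k' : ℕ, Sum.inr (i, k) ∈ β → Sum.inr (i', k') ∈ β → i ≠ k' ∧ i' ≠ k)

/-- The `c_{m-1} - w·c_{m-2}` edges of `D_n` immediately preceding the vertex `v_i`. -/
def precEdges (r n i m w : ℕ) : Finset ℕ :=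
  Finset.Icc (vpos r n i + 1 - (c r (m - 1) - (w : ℤ) * c r (m - 2)).toNat) (vpos r n i)

/-- The set `F(D_n)`. -/
def FD (r n : ℕ) : Set (Finset Elt) :=
  {β | validColl r n β ∧
    ∀ i k m w : ℕ, Sum.inr (i, k) ∈ β → isGreenMW r n i k m w →
      ∃ e ∈ precEdges r n i m w, ∃ p ∈ β, e ∈ edges r n p}

/-- The set `F̃(D_n)`. -/
def Ftilde (r n : ℕ) : Set (Finset Elt) := {β | validColl r n β}

/-- The set `T^{≥u}(D_n)`. -/
def Tge (r n u : ℕ) : Set (Finset Elt) :=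
  {β | validColl r n β ∧ β.Nonempty ∧
    ∃ i k m w : ℕ, u ≤ m ∧ Sum.inr (i, k) ∈ β ∧ isGreenMW r n i k m w ∧
      ∀ e ∈ precEdges r n i m w, ∀ p ∈ β, e ∉ edges r n p}

/-- `|β_j|_1` for a single element. -/
def wt1 : Elt → ℕ
  | Sum.inl _ => 0
  | Sum.inr (i, k) => k - i

/-- `|β|_1`. -/
def B1 (β : Finset Elt) : ℕ := ∑ p ∈ β, wt1 p

/-- `|β|_2`: the total number of edges in the collection `β`. -/
def B2 (r n : ℕ) (β : Finset Elt) : ℕ := (β.biUnion (edges r n)).card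

/-- The field `ℚ(x₁,x₂)`. -/
abbrev K := FractionRing (MvPolynomial (Fin 2) ℚ)

/-- The indeterminate `x₁`. -/
def x₁ : K := algebraMap (MvPolynomial (Fin 2) ℚ) K (MvPolynomial.X 0)

/-- The indeterminate `x₂`. -/
def x₂ : K := algebraMap (MvPolynomial (Fin 2) ℚ) K (MvPolynomial.X 1)

/-- `b_{n-1,k}`: `r` if the edge `α_k` of `D_n` is horizontal, `r-1` if vertical. -/
def bseq (r n k : ℕ) : ℕ := if isVert r n k then r - 1 else r

/-- Prefix sums `S e = Σ_{k=1}^{e} b_{n-1,k}`. -/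
def S (r n e : ℕ) : ℕ := ∑ k ∈ Finset.Icc 1 e, bseq r n k

/-- The interval `[a,b] ⊆ [1,c_n]` is (the edge set of) a blue or green subpath of `D_{n+1}`. -/
def isBGinterval (r n a b : ℕ) : Prop :=
  ∃ i k : ℕ, i < k ∧ (k : ℤ) ≤ c r (n - 1) ∧ ¬ isRed r (n + 1) i k ∧
    Finset.Icc a b = Finset.Icc (vpos r (n + 1) i + 1) (vpos r (n + 1) k)

/-- Left endpoints of the maximal interval components of `V`. -/
def starts (V : Finset ℕ) : Finset ℕ := V.filter fun e => e - 1 ∉ V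

/-- Right endpoint of the maximal interval component of `V` starting at `e`. -/
def compEnd (V : Finset ℕ) (e : ℕ) : ℕ := sSup {g : ℕ | Finset.Icc e g ⊆ V}

/-- `f_i(V)`: the image of the maximal interval component of `V` starting at `e`. -/
def fcomp (r n : ℕ) (V : Finset ℕ) (e : ℕ) : Finset ℕ :=
  if isBGinterval r n (S r n (e - 1) + 1) (S r n (compEnd V e)) then
    Finset.Icc (S r n (e - 1) + 1) (S r n (compEnd V e))
  else
    insert (S r n (e - 1)) (Finset.Icc (S r n (e - 1) + 1) (S r n (compEnd V e)))

/-- The map `f` from subsets of `[1,c_{n-1}]` to subsets of `[1,c_n]`. -/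
def fmap (r n : ℕ) (V : Finset ℕ) : Finset ℕ := (starts V).biUnion (fcomp r n V)

/-- The pull-back `f*` (of the map `f` one level down, from subsets of `[1,c_{n-2}]`
to subsets of `[1,c_{n-1}]`). -/
def fstar (r n : ℕ) (W : Finset ℕ) : Finset ℕ :=
  ((Finset.Icc 1 (cN r (n - 2))).powerset.filter fun U => fmap r (n - 1) U ⊆ W).biUnion id

/-- `δ` of a maximal interval component `[e,g]`: `1` if the `w`-th edge of the corresponding
subpath of `D_n` is vertical for some `2 ≤ w ≤ r-1`, and `0` otherwise. -/
def deltaComp (r n e g : ℕ) : ℕ :=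
  if ∃ w : ℕ, 2 ≤ w ∧ w ≤ r - 1 ∧ e + w - 1 ≤ g ∧ isVert r n (e + w - 1) then 1 else 0

/-- `δ_V`. -/
def deltaV (r n : ℕ) (V : Finset ℕ) : ℕ :=
  ∑ e ∈ starts V, deltaComp r n e (compEnd V e)

/-- Generalized binomial coefficient for integers `A`, `B`. -/
def gbinom (A B : ℤ) : ℚ :=
  if B < 0 then 0
  else (∏ i ∈ Finset.range B.toNat, ((A : ℚ) - (i : ℚ))) / (B.toNat.factorial : ℚ)

/-- `z_n` for `n ≥ 4`, given by the sum over `F̃(D_n)`. -/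
def zF (r n : ℕ) : K :=
  x₁ ^ (-(c r (n - 1))) * x₂ ^ (-(c r (n - 2))) *
    ∑ᶠ β ∈ Ftilde r n,
      x₁ ^ ((r : ℤ) * (B1 β : ℤ)) * x₂ ^ ((r : ℤ) * (c r (n - 1) - (B2 r n β : ℤ)))

/-- `z_n`, with `z_3 = x_3` (the value `x3` is the cluster variable `x_3`). -/
def z (r : ℕ) (x3 : K) (n : ℕ) : K := if n = 3 then x3 else zF r n

end

noncomputable section
set_option linter.unusedSectionVars false

/-- Prefix sums over the integers. -/
def ps (g : ℤ → ℤ) (k : ℤ) : ℤ := ∑ t ∈ Finset.Ioc 0 k, g t - ∑ t ∈ Finset.Ioc k 0, g t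

lemma ps_step (g : ℤ → ℤ) (k : ℤ) : ps g k = ps g (k - 1) + g k := by
  unfold ps
  rcases le_or_gt 1 k with h | h
  · have h1 : Finset.Ioc 0 k = insert k (Finset.Ioc 0 (k - 1)) := by
      ext x; simp only [Finset.mem_Ioc, Finset.mem_insert]; omega
    have h2 : Finset.Ioc k 0 = ∅ := Finset.Ioc_eq_empty (by omega)
    have h3 : Finset.Ioc (k - 1) 0 = ∅ := Finset.Ioc_eq_empty (by omega)
    rw [h1, h2, h3, Finset.sum_insert (by simp)]; simp; ring
  · have h1 : Finset.Ioc (k - 1) 0 = insert k (Finset.Ioc k 0) := by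
      ext x; simp only [Finset.mem_Ioc, Finset.mem_insert]; omega
    have h2 : Finset.Ioc 0 k = ∅ := Finset.Ioc_eq_empty (by omega)
    have h3 : Finset.Ioc 0 (k - 1) = ∅ := Finset.Ioc_eq_empty (by omega)
    rw [h1, h2, h3, Finset.sum_insert (by simp)]; simp

lemma const_of_step (D : ℤ → ℤ) (h : ∀ k, D k = D (k - 1)) (k : ℤ) : D k = D 0 := by
  induction k using Int.induction_on with
  | zero => rfl
  | succ i ih => rw [h]; simpa using ih
  | pred i ih => rw [← h]; exact ih

lemma inc_congr (G G' : ℤ → ℤ) (a b : ℤ) (hab : a ≤ b)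
    (h : ∀ k, a < k → k ≤ b → G k - G (k - 1) = G' k - G' (k - 1)) :
    G b - G a = G' b - G' a := by
  induction b, hab using Int.leInduction with
  | base => ring
  | succ b hb ih =>
    have h1 := ih (fun k hk hk' => h k hk (by omega))
    have h2 := h (b + 1) (by omega) le_rfl
    simp only [add_sub_cancel_right] at h2
    linarith

variable {L : ℕ} [NeZero L]

/-- Indicator of a residue set, on the integers. -/
def ind (S : Finset (ZMod L)) (k : ℤ) : ℤ := if (k : ZMod L) ∈ S then 1 else 0

/-- Counting function of a periodic set. -/
def cnt (S : Finset (ZMod L)) (k : ℤ) : ℤ := ps (ind S) k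

lemma cnt_mem {S : Finset (ZMod L)} {k : ℤ} (h : (k : ZMod L) ∈ S) :
    cnt S k = cnt S (k - 1) + 1 := by
  unfold cnt; rw [ps_step]; simp [ind, h]

lemma cnt_not {S : Finset (ZMod L)} {k : ℤ} (h : (k : ZMod L) ∉ S) :
    cnt S k = cnt S (k - 1) := by
  unfold cnt; rw [ps_step]; simp [ind, h]

lemma cnt_period (S : Finset (ZMod L)) (k : ℤ) : cnt S (k + L) = cnt S k + S.card := by
  have h := const_of_step (fun k => cnt S (k + L) - cnt S k) (by
    intro k
    have e : ((k + L : ℤ) : ZMod L) = (k : ZMod L) := by push_cast; simp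
    have e2 : k + (L : ℤ) - 1 = k - 1 + L := by ring
    by_cases hk : (k : ZMod L) ∈ S
    · have h1 := cnt_mem hk
      have h2 := cnt_mem (k := k + L) (by rw [e]; exact hk)
      rw [e2] at h2
      linarith
    · have h1 := cnt_not hk
      have h2 := cnt_not (k := k + L) (by rw [e]; exact hk)
      rw [e2] at h2
      linarith) k
  have h0 : cnt S 0 = 0 := by simp [cnt, ps]
  have hL : cnt S L = S.card := by
    have : ∑ t ∈ Finset.Ioc (0 : ℤ) L, ind S t = ∑ x : ZMod L, if x ∈ S then (1 : ℤ) else 0 := by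
      refine Finset.sum_nbij' (fun t => (t : ZMod L)) (fun x => ((x - 1).val : ℤ) + 1) ?_ ?_ ?_ ?_ ?_
      · simp
      · intro x _
        have := ZMod.val_lt (x - 1)
        simp only [Finset.mem_Ioc]; omega
      · intro t ht
        simp only [Finset.mem_Ioc] at ht
        have : ((((t - 1 : ℤ) : ZMod L)).val : ℤ) = (t - 1) % L := ZMod.val_intCast _
        rw [Int.emod_eq_of_lt (by omega) (by omega)] at this
        push_cast at this
        linarith
      · intro x _
        simp
      · intro t _; rfl
    have hn : Finset.Ioc (L : ℤ) 0 = ∅ := Finset.Ioc_eq_empty (by omega)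
    unfold cnt ps
    rw [this, hn]; simp
  simp only [zero_add, h0, hL] at h
  linarith

lemma cnt_period_mul (F : ℤ → ℤ) (d : ℤ) (h : ∀ k, F (k + L) = F k + d) (k m : ℤ) :
    F (k + L * m) = F k + d * m := by
  induction m using Int.induction_on with
  | zero => simp
  | succ i ih =>
    have := h (k + L * i)
    rw [show k + (L : ℤ) * (i + 1) = k + L * i + L by ring, this, ih]; ring
  | pred i ih =>
    have := h (k + L * (-i - 1))
    rw [show k + (L : ℤ) * (-i - 1) + L = k + L * (-i) by ring, ih] at this
    linarith

/-- Functions of nonnegative drift have a point that is a minimum of their future. -/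
lemma exists_future_min (F : ℤ → ℤ) (d : ℤ) (hd : 0 ≤ d) (h : ∀ k, F (k + L) = F k + d) (t : ℤ) :
    ∃ a, t ≤ a ∧ ∀ s, t ≤ s → F a ≤ F s := by
  have hL : (0 : ℤ) < L := by exact_mod_cast Nat.pos_of_ne_zero (NeZero.ne L)
  obtain ⟨a, ha, hmin⟩ := Finset.exists_min_image (Finset.Ico t (t + L)) F
    ⟨t, by simp only [Finset.mem_Ico]; omega⟩
  simp only [Finset.mem_Ico] at ha hmin
  refine ⟨a, ha.1, fun s hs => ?_⟩
  have h1 := Int.emod_add_mul_ediv (s - t) L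
  have h2 := Int.emod_nonneg (s - t) hL.ne'
  have h3 := Int.emod_lt_of_pos (s - t) hL
  have h4 : 0 ≤ (s - t) / L := Int.ediv_nonneg (by omega) hL.le
  have h5 := cnt_period_mul F d h (t + (s - t) % L) ((s - t) / L)
  rw [show t + (s - t) % L + L * ((s - t) / L) = s by linarith] at h5
  have h6 := hmin (t + (s - t) % L) ⟨by omega, by omega⟩
  have := mul_nonneg hd h4
  linarith

lemma exists_strict_future_min (F : ℤ → ℤ) (d : ℤ) (hd : 0 < d) (h : ∀ k, F (k + L) = F k + d) :
    ∃ a, ∀ s, a < s → F a < F s := by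
  have hL : (0 : ℤ) < L := by exact_mod_cast Nat.pos_of_ne_zero (NeZero.ne L)
  obtain ⟨b, hb, hb'⟩ := exists_future_min (L := L) (fun k => L * F k - k) (L * d - L)
    (by nlinarith) (by intro k; rw [h k]; ring) 0
  refine ⟨b, fun s hs => ?_⟩
  have := hb' s (by omega)
  by_contra hc
  push Not at hc
  nlinarith

/-- Height function attached to the vertical choices. -/
def FF (r : ℕ) (V S2 : Finset (ZMod L)) (k : ℤ) : ℤ := k - cnt V k - r * cnt S2 k

/-- Height function attached to the horizontal choices. -/
def EE (r : ℕ) (V S1 : Finset (ZMod L)) (k : ℤ) : ℤ := r * cnt S1 k - cnt V k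

/-- Compatibility of pairs. -/
def Comp (r : ℕ) (V S1 S2 : Finset (ZMod L)) : Prop :=
  ∀ i j : ℤ, i < j → (i : ZMod L) ∈ S1 → (j : ZMod L) ∈ S2 →
    (∀ k, i ≤ k → k < j → FF r V S2 j < FF r V S2 k) →
    ∃ k, i ≤ k ∧ k < j ∧ EE r V S1 k ≤ EE r V S1 (i - 1)

lemma FF_period (r : ℕ) (V S2 : Finset (ZMod L)) (k : ℤ) :
    FF r V S2 (k + L) = FF r V S2 k + (L - V.card - r * S2.card) := by
  unfold FF; rw [cnt_period, cnt_period]; ring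

lemma EE_period (r : ℕ) (V S1 : Finset (ZMod L)) (k : ℤ) :
    EE r V S1 (k + L) = EE r V S1 k + (r * S1.card - V.card) := by
  unfold EE; rw [cnt_period, cnt_period]; ring

lemma FF_H {r : ℕ} {V S2 : Finset (ZMod L)} (h2 : S2 ⊆ V) {k : ℤ} (hk : (k : ZMod L) ∉ V) :
    FF r V S2 k = FF r V S2 (k - 1) + 1 := by
  unfold FF; rw [cnt_not hk, cnt_not (fun h => hk (h2 h))]; ring

lemma FF_V {r : ℕ} {V S2 : Finset (ZMod L)} {k : ℤ} (hk : (k : ZMod L) ∈ V)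
    (hk2 : (k : ZMod L) ∉ S2) : FF r V S2 k = FF r V S2 (k - 1) := by
  unfold FF; rw [cnt_mem hk, cnt_not hk2]; ring

lemma FF_S {r : ℕ} {V S2 : Finset (ZMod L)} (h2 : S2 ⊆ V) {k : ℤ} (hk : (k : ZMod L) ∈ S2) :
    FF r V S2 k = FF r V S2 (k - 1) - r := by
  unfold FF; rw [cnt_mem hk, cnt_mem (h2 hk)]; ring

lemma EE_S {r : ℕ} {V S1 : Finset (ZMod L)} (h1 : Disjoint S1 V) {k : ℤ} (hk : (k : ZMod L) ∈ S1) :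
    EE r V S1 k = EE r V S1 (k - 1) + r := by
  unfold EE; rw [cnt_mem hk, cnt_not (Finset.disjoint_left.1 h1 hk)]; ring

lemma EE_H {r : ℕ} {V S1 : Finset (ZMod L)} {k : ℤ} (hk : (k : ZMod L) ∉ S1)
    (hV : (k : ZMod L) ∉ V) : EE r V S1 k = EE r V S1 (k - 1) := by
  unfold EE; rw [cnt_not hk, cnt_not hV]

lemma EE_V {r : ℕ} {V S1 : Finset (ZMod L)} (h1 : Disjoint S1 V) {k : ℤ} (hk : (k : ZMod L) ∈ V) :
    EE r V S1 k = EE r V S1 (k - 1) - 1 := by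
  unfold EE; rw [cnt_mem hk, cnt_not (Finset.disjoint_right.1 h1 hk)]; ring

lemma EE_le_of_not {r : ℕ} {V S1 : Finset (ZMod L)} {k : ℤ}
    (hk : (k : ZMod L) ∉ S1) : EE r V S1 k ≤ EE r V S1 (k - 1) := by
  unfold EE; rw [cnt_not hk]
  by_cases h : (k : ZMod L) ∈ V
  · rw [cnt_mem h]; linarith
  · rw [cnt_not h]

lemma FF_le_of_not {r : ℕ} {V S2 : Finset (ZMod L)} {k : ℤ}
    (hk : (k : ZMod L) ∉ S2) : FF r V S2 (k - 1) ≤ FF r V S2 k := by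
  unfold FF; rw [cnt_not hk]
  by_cases h : (k : ZMod L) ∈ V
  · rw [cnt_mem h]; linarith
  · rw [cnt_not h]; linarith

/-- No compatible pairs with both sets large. -/
lemma not_comp_of_large {r : ℕ} {V S1 S2 : Finset (ZMod L)}
    (hF : (L : ℤ) - V.card < r * S2.card) (hE : (V.card : ℤ) < r * S1.card) :
    ¬ Comp r V S1 S2 := by
  intro hc
  have hL : (0 : ℤ) < L := by exact_mod_cast Nat.pos_of_ne_zero (NeZero.ne L)
  obtain ⟨a, ha⟩ := exists_strict_future_min (L := L) (fun k => FF r V S2 (-k))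
    (r * S2.card - (L - V.card)) (by linarith) (by
      intro k
      have := FF_period r V S2 (-(k + L))
      rw [show -(k + (L : ℤ)) + L = -k by ring] at this
      linarith)
  obtain ⟨b, hb⟩ := exists_strict_future_min (EE r V S1) _ (by linarith) (EE_period r V S1)
  -- shift b to the left of -a
  have hj : ∀ k, k < -a → FF r V S2 (-a) < FF r V S2 k := by
    intro k hk; have := ha (-k) (by omega); simpa using this
  obtain ⟨m, hm⟩ : ∃ m : ℤ, b + L * m + 1 < -a := by
    refine ⟨-(|b| + |a| + 2), ?_⟩
    have h1 := neg_abs_le a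
    have h2 := le_abs_self a
    have h3 := le_abs_self b
    have h4 := abs_nonneg b
    nlinarith [abs_nonneg a]
  have hb' : ∀ s, b + L * m < s → EE r V S1 (b + L * m) < EE r V S1 s := by
    intro s hs
    have h1 := cnt_period_mul (L := L) _ _ (EE_period r V S1) b m
    have h2 := cnt_period_mul (L := L) _ _ (EE_period r V S1) (s - L * m) m
    rw [show s - (L : ℤ) * m + L * m = s by ring] at h2
    have := hb (s - L * m) (by linarith)
    linarith
  set i := b + L * m + 1 with hi
  have hi1 : i - 1 = b + L * m := by rw [hi]; ring
  obtain ⟨k, hk1, hk2, hk3⟩ := hc i (-a) hm (by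
      by_contra hn
      have := EE_le_of_not (r := r) (V := V) hn
      rw [hi1] at this
      have := hb' i (by omega)
      linarith) (by
      by_contra hn
      have := FF_le_of_not (r := r) (V := V) hn
      have := hj (-a - 1) (by omega)
      linarith) (fun k _ hk => hj k hk)
  rw [hi1] at hk3
  have := hb' k (by omega)
  linarith

/-- The horizontal steps that are not in the shadow. -/
def free (r : ℕ) (V S2 : Finset (ZMod L)) : Finset (ZMod L) :=
  Finset.univ.filter fun x => x ∉ V ∧ ∃ i : ℤ, (i : ZMod L) = x ∧
    ∀ j, i ≤ j → FF r V S2 (i - 1) < FF r V S2 j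

lemma mem_free {r : ℕ} {V S2 : Finset (ZMod L)} {i : ℤ} :
    (i : ZMod L) ∈ free r V S2 ↔
      (i : ZMod L) ∉ V ∧ ∀ j, i ≤ j → FF r V S2 (i - 1) < FF r V S2 j := by
  unfold free
  simp only [Finset.mem_filter, Finset.mem_univ, true_and]
  refine and_congr_right fun _ => ⟨?_, fun h => ⟨i, rfl, h⟩⟩
  rintro ⟨i', hi', h⟩ j hj
  rw [ZMod.intCast_eq_intCast_iff_dvd_sub] at hi'
  obtain ⟨m, hm⟩ := hi'
  have h1 := cnt_period_mul (L := L) _ _ (FF_period r V S2) (i' - 1) m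
  have h2 := cnt_period_mul (L := L) _ _ (FF_period r V S2) (j - L * m) m
  rw [show i' - 1 + (L : ℤ) * m = i - 1 by linarith] at h1
  rw [show j - (L : ℤ) * m + L * m = j by ring] at h2
  have := h (j - L * m) (by linarith)
  linarith

lemma free_card {r : ℕ} {V S2 : Finset (ZMod L)} (h2 : S2 ⊆ V)
    (hd : 0 ≤ (L : ℤ) - V.card - r * S2.card) :
    ((free r V S2).card : ℤ) = (L : ℤ) - V.card - r * S2.card := by
  choose a ha hmin using exists_future_min (L := L) (FF r V S2) _ hd (FF_period r V S2)
  set m : ℤ → ℤ := fun t => FF r V S2 (a t) with hm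
  have mle : ∀ t s, t ≤ s → m t ≤ FF r V S2 s := hmin
  have lem : ∀ t x, (∀ s, t ≤ s → x ≤ FF r V S2 s) → x ≤ m t := fun t x h => h _ (ha t)
  have hstep : ∀ t, m t = m (t - 1) + ind (free r V S2) t := by
    intro t
    unfold ind
    split_ifs with h
    · rw [mem_free] at h
      have e := FF_H (r := r) h2 h.1
      have b1 : m t = FF r V S2 t := le_antisymm (mle _ _ le_rfl)
        (lem _ _ fun s hs => by have := h.2 s hs; linarith)
      have b2 : m (t - 1) = FF r V S2 (t - 1) := by
        refine le_antisymm (mle _ _ le_rfl) (lem _ _ fun s hs => ?_)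
        rcases eq_or_lt_of_le hs with h' | h'
        · rw [h']
        · exact (h.2 s (by omega)).le
      linarith
    · rw [mem_free] at h
      rw [add_zero]
      refine le_antisymm (lem _ _ fun s hs => ?_) (lem _ _ fun s hs => mle _ _ (by omega))
      rcases eq_or_lt_of_le hs with h' | h'
      · rw [← h']
        by_cases hV : (t : ZMod L) ∈ V
        · by_cases hS : (t : ZMod L) ∈ S2
          · have := FF_S (r := r) h2 hS
            have := mle t t le_rfl
            have : (0 : ℤ) ≤ r := by positivity
            linarith
          · have := FF_V (r := r) hV hS
            have := mle t t le_rfl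
            linarith
        · push Not at h
          obtain ⟨j, hj, hj'⟩ := h hV
          exact (mle _ _ hj).trans hj'
      · exact mle _ _ (by omega)
  have hc := const_of_step (fun k => m k - cnt (free r V S2) k) (by
    intro k
    have h1 := hstep k
    have h2 : cnt (free r V S2) k = cnt (free r V S2) (k - 1) + ind (free r V S2) k := ps_step _ _
    linarith)
  have p1 : m (0 + L) = m 0 + ((L : ℤ) - V.card - r * S2.card) := by
    refine le_antisymm ?_ ?_
    · have := mle (0 + L) (a 0 + L) (by have := ha 0; linarith)
      rw [FF_period] at this
      exact this
    · refine lem _ _ fun s hs => ?_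
      have := mle 0 (s - L) (by linarith)
      have e := FF_period r V S2 (s - L)
      rw [sub_add_cancel] at e
      linarith
  have p2 := cnt_period (free r V S2) 0
  have p3 := hc (0 + L)
  linarith

/-- Compatibility depends only on the shadowed part of `S1`. -/
lemma comp_iff_sdiff {r : ℕ} {V S1 S2 : Finset (ZMod L)} (h2 : S2 ⊆ V) :
    Comp r V S1 S2 ↔ Comp r V (S1 \ free r V S2) S2 := by
  have key : ∀ i j : ℤ, (i : ZMod L) ∈ S1 →
      (∀ k, i ≤ k → k < j → FF r V S2 j < FF r V S2 k) → i < j →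
      ((i : ZMod L) ∈ S1 \ free r V S2) ∧ ∀ k, i ≤ k → k < j →
        EE r V S1 k - EE r V S1 (i - 1) =
          EE r V (S1 \ free r V S2) k - EE r V (S1 \ free r V S2) (i - 1) := by
    intro i j hi hF hij
    have hnf : ∀ k : ℤ, i ≤ k → k < j → (k : ZMod L) ∉ free r V S2 := by
      intro k hk hk' hf
      rw [mem_free] at hf
      have hh := hf.2 j (by omega)
      have e := FF_H (r := r) h2 hf.1
      have := hF k hk hk'
      linarith
    refine ⟨Finset.mem_sdiff.2 ⟨hi, hnf i le_rfl hij⟩, fun k hk hk' => ?_⟩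
    refine inc_congr _ _ _ _ (by omega) fun t ht ht' => ?_
    have h3 := hnf t (by omega) (by omega)
    unfold EE
    by_cases hS : (t : ZMod L) ∈ S1
    · rw [cnt_mem hS, cnt_mem (Finset.mem_sdiff.2 ⟨hS, h3⟩)]; ring
    · rw [cnt_not hS, cnt_not (fun h => hS (Finset.mem_sdiff.1 h).1)]; ring
  constructor
  · intro hc i j hij hi hj hF
    have hi' := (Finset.mem_sdiff.1 hi).1
    obtain ⟨k, hk, hk', hE⟩ := hc i j hij hi' hj hF
    refine ⟨k, hk, hk', ?_⟩
    have := (key i j hi' hF hij).2 k hk hk'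
    linarith
  · intro hc i j hij hi hj hF
    obtain ⟨hi', hk⟩ := key i j hi hF hij
    obtain ⟨k, hk1, hk2, hE⟩ := hc i j hij hi' hj hF
    refine ⟨k, hk1, hk2, ?_⟩
    have := hk k hk1 hk2
    linarith

/-- The balance property used for the support bound. -/
def Bal (V : Finset (ZMod L)) (a1 a2 : ℤ) : Prop :=
  ∀ s t : ℤ, s < t → ((s + 1 : ℤ) : ZMod L) ∉ V → (t : ZMod L) ∈ V →
    a1 * (cnt V t - cnt V s - 1) < a2 * ((t - s) - (cnt V t - cnt V s))

lemma support_bound {r : ℕ} (hr : 1 ≤ r) {V S1 S2 : Finset (ZMod L)} {a1 a2 : ℤ}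
    (ha1 : 0 ≤ a1) (h1 : Disjoint S1 V) (h2 : S2 ⊆ V)
    (hd : 0 ≤ (L : ℤ) - V.card - r * S2.card) (hbal : Bal V a1 a2)
    (hfree : Disjoint S1 (free r V S2)) (hc : Comp r V S1 S2) :
    (S1.card = 0 ∧ S2.card = 0) ∨ a1 * (r * S1.card) < a2 * (r * S2.card) := by
  have hr' : (1 : ℤ) ≤ r := by exact_mod_cast hr
  obtain ⟨A, hA0, hA⟩ := exists_future_min (L := L) (FF r V S2) _ hd (FF_period r V S2) 0
  have main : ∀ n : ℕ, ∀ t : ℤ, t = A + n → (∀ s, t ≤ s → FF r V S2 t ≤ FF r V S2 s) →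
      (cnt S1 t = cnt S1 A ∧ cnt S2 t = cnt S2 A) ∨
        a1 * (r * (cnt S1 t - cnt S1 A)) < a2 * (r * (cnt S2 t - cnt S2 A)) := by
    intro n
    induction n using Nat.strong_induction_on with
    | _ n ih =>
    intro t htn ht
    rcases Nat.eq_zero_or_pos n with hn | hn
    · left; subst hn; simp at htn; subst htn; simp
    by_cases hS : (t : ZMod L) ∈ S2
    · -- jump
      have hFt := FF_S (r := r) h2 hS
      have hex : ∃ s, (s < t ∧ FF r V S2 s ≤ FF r V S2 t) ∧
          ∀ z, (z < t ∧ FF r V S2 z ≤ FF r V S2 t) → z ≤ s := by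
        refine Int.exists_greatest_of_bdd ⟨t, fun z hz => hz.1.le⟩
          ⟨A, by omega, hA t (by omega)⟩
      obtain ⟨s, ⟨hst, hs⟩, hmax⟩ := hex
      have hAs : A ≤ s := hmax A ⟨by omega, hA t (by omega)⟩
      have hgt : ∀ k, s < k → k < t → FF r V S2 t < FF r V S2 k := by
        intro k hk hk'
        by_contra hcon
        have := hmax k ⟨hk', by linarith⟩
        omega
      have hs1 : s + 1 < t := by
        by_contra hcon
        have : s = t - 1 := by omega
        rw [this] at hs
        linarith
      have hgs := hgt (s + 1) (by omega) hs1
      have hsS : ((s + 1 : ℤ) : ZMod L) ∉ S2 := by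
        intro h
        have := FF_S (r := r) h2 h
        simp only [add_sub_cancel_right] at this
        linarith
      have hsV : ((s + 1 : ℤ) : ZMod L) ∉ V := by
        intro h
        have := FF_V (r := r) h hsS
        simp only [add_sub_cancel_right] at this
        linarith
      have hFs : FF r V S2 s = FF r V S2 t := by
        have := FF_H (r := r) h2 hsV
        simp only [add_sub_cancel_right] at this
        linarith
      have hfut : ∀ x, s ≤ x → FF r V S2 s ≤ FF r V S2 x := by
        intro x hx
        rcases eq_or_lt_of_le hx with h | h
        · rw [h]
        · rcases lt_or_ge x t with h' | h'
          · rw [hFs]; exact (hgt x h h').le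
          · rw [hFs]; exact ht x h'
      -- coverage
      have hE : EE r V S1 (t - 1) ≤ EE r V S1 s := by
        by_contra hcon
        push Not at hcon
        have hex : ∃ i, (s ≤ i ∧ i < t - 1 ∧ EE r V S1 i ≤ EE r V S1 s) ∧
            ∀ z, (s ≤ z ∧ z < t - 1 ∧ EE r V S1 z ≤ EE r V S1 s) → z ≤ i := by
          refine Int.exists_greatest_of_bdd ⟨t, fun z hz => by omega⟩
            ⟨s, le_rfl, by omega, le_rfl⟩
        obtain ⟨i, ⟨hi1, hi2, hi3⟩, himax⟩ := hex
        have hup : ∀ k, i < k → k < t → EE r V S1 s < EE r V S1 k := by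
          intro k hk hk'
          rcases eq_or_lt_of_le (show k ≤ t - 1 by omega) with h | h
          · rw [h]; exact hcon
          · by_contra hcc
            have := himax k ⟨by omega, h, by linarith⟩
            omega
        have hiS : ((i + 1 : ℤ) : ZMod L) ∈ S1 := by
          by_contra hn
          have := EE_le_of_not (r := r) (V := V) hn
          simp only [add_sub_cancel_right] at this
          have := hup (i + 1) (by omega) (by omega)
          linarith
        obtain ⟨k, hk1, hk2, hk3⟩ := hc (i + 1) t (by omega) hiS hS
          (fun k hk hk' => hgt k (by omega) hk')
        simp only [add_sub_cancel_right] at hk3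
        have := hup k (by omega) hk2
        linarith
      have hb := hbal s t hst hsV (h2 hS)
      have ht1 : cnt S1 t = cnt S1 (t - 1) := cnt_not (Finset.disjoint_right.1 h1 (h2 hS))
      have ht2 : cnt V t = cnt V (t - 1) + 1 := cnt_mem (h2 hS)
      have e1 : r * (cnt S1 t - cnt S1 s) ≤ cnt V t - cnt V s - 1 := by
        unfold EE at hE
        rw [ht1, ht2]; linarith
      have e2 : (t - s) - (cnt V t - cnt V s) = r * (cnt S2 t - cnt S2 s) := by
        unfold FF at hFs; linarith
      rw [e2] at hb
      have e3 := mul_le_mul_of_nonneg_left e1 ha1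
      right
      rcases ih (s - A).toNat (by omega) s (by omega) hfut with h | h
      · rw [← h.1, ← h.2]; linarith
      · linarith
    · have hle := FF_le_of_not (r := r) (V := V) hS
      have htS1 : (t : ZMod L) ∉ S1 := by
        intro h
        have hV := Finset.disjoint_left.1 h1 h
        have hf := Finset.disjoint_left.1 hfree h
        rw [mem_free] at hf
        push Not at hf
        obtain ⟨j, hj, hj'⟩ := hf hV
        have := ht j hj
        have := FF_H (r := r) h2 hV
        linarith
      have := ih (n - 1) (by omega) (t - 1) (by omega) (by
        intro s hs
        rcases eq_or_lt_of_le hs with h | h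
        · rw [h]
        · exact hle.trans (ht s (by omega)))
      rw [cnt_not hS, cnt_not htS1]
      exact this
  have hfin := main L (A + L) rfl (by
    intro s hs
    have := hA (s - L) (by linarith)
    have e := FF_period r V S2 (s - L)
    rw [sub_add_cancel] at e
    rw [FF_period]
    linarith)
  rw [cnt_period, cnt_period] at hfin
  rcases hfin with h | h
  · left; constructor <;> [have := h.1; have := h.2] <;> omega
  · right; simpa using h

end

noncomputable section
set_option linter.unusedSectionVars false
variable {L : ℕ} [NeZero L]

/-- Negation of a residue set. -/
def ng (S : Finset (ZMod L)) : Finset (ZMod L) := Finset.univ.filter fun x => -x ∈ S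

lemma mem_ng {S : Finset (ZMod L)} {x : ZMod L} : x ∈ ng S ↔ -x ∈ S := by simp [ng]

lemma ng_ng (S : Finset (ZMod L)) : ng (ng S) = S := by ext x; simp [mem_ng]

lemma ng_card (S : Finset (ZMod L)) : (ng S).card = S.card := by
  refine Finset.card_nbij' (fun x => -x) (fun x => -x) ?_ ?_ ?_ ?_ <;> intro x <;> simp [mem_ng]

lemma cnt_zero (S : Finset (ZMod L)) : cnt S 0 = 0 := by simp [cnt, ps]

lemma cnt_ng (S : Finset (ZMod L)) (k : ℤ) : cnt (ng S) k = cnt S (-1) - cnt S (-k - 1) := by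
  have := const_of_step (fun k => cnt (ng S) k + cnt S (-k - 1)) (by
    intro k
    have e : -(k - 1) - 1 = -k := by ring
    simp only [e]
    by_cases h : ((-k : ℤ) : ZMod L) ∈ S
    · have h1 := cnt_mem h
      have h2 := cnt_mem (S := ng S) (k := k) (by rw [mem_ng]; push_cast at h; exact h)
      linarith
    · have h1 := cnt_not h
      have h2 := cnt_not (S := ng S) (k := k) (by rw [mem_ng]; push_cast at h; exact h)
      linarith) k
  simp only [cnt_zero] at this
  simp at this
  linarith

lemma cnt_compl (S : Finset (ZMod L)) (k : ℤ) : cnt Sᶜ k = k - cnt S k := by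
  have := const_of_step (fun k => cnt Sᶜ k + cnt S k - k) (by
    intro k
    by_cases h : (k : ZMod L) ∈ S
    · have h1 := cnt_mem h
      have h2 := cnt_not (S := Sᶜ) (k := k) (by simpa using h)
      linarith
    · have h1 := cnt_not h
      have h2 := cnt_mem (S := Sᶜ) (k := k) (by simpa using h)
      linarith) k
  simp only [cnt_zero] at this
  simp at this
  linarith

lemma cnt_rev (V : Finset (ZMod L)) (k : ℤ) :
    cnt (ng Vᶜ) k = k - cnt V (-1) + cnt V (-k - 1) := by
  rw [cnt_ng, cnt_compl, cnt_compl]; ring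

lemma rev_rev (V : Finset (ZMod L)) : ng (ng Vᶜ)ᶜ = V := by ext x; simp [mem_ng]

lemma comp_rev_aux {r : ℕ} {V S1 S2 : Finset (ZMod L)} (h : Comp r V S1 S2) :
    Comp r (ng Vᶜ) (ng S2) (ng S1) := by
  have hF : ∀ k, FF r (ng Vᶜ) (ng S1) k = EE r V S1 (-k - 1) + (cnt V (-1) - r * cnt S1 (-1)) := by
    intro k; unfold FF EE; rw [cnt_rev, cnt_ng]; ring
  have hE : ∀ k, EE r (ng Vᶜ) (ng S2) k = FF r V S2 (-k - 1) + (cnt V (-1) + 1 + r * cnt S2 (-1)) := by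
    intro k; unfold FF EE; rw [cnt_rev, cnt_ng]; ring
  intro i j hij hi hj hk
  rw [mem_ng] at hi hj
  by_contra hcon
  push Not at hcon
  obtain ⟨k, h1, h2, h3⟩ := h (-j) (-i) (by omega) (by push_cast; exact hj) (by push_cast; exact hi) (by
    intro k h1 h2
    have := hcon (-k - 1) (by omega) (by omega)
    rw [hE, hE] at this
    have e1 : -(i - 1) - 1 = -i := by ring
    have e2 : -(-k - 1) - 1 = k := by ring
    rw [e1, e2] at this
    linarith)
  have := hk (-k - 1) (by omega) (by omega)
  rw [hF, hF] at this
  have e2 : -(-k - 1) - 1 = k := by ring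
  rw [e2] at this
  linarith

lemma comp_rev {r : ℕ} {V S1 S2 : Finset (ZMod L)} :
    Comp r V S1 S2 ↔ Comp r (ng Vᶜ) (ng S2) (ng S1) := by
  refine ⟨comp_rev_aux, fun h => ?_⟩
  have := comp_rev_aux h
  rwa [rev_rev, ng_ng, ng_ng] at this

/-- Second balance condition. -/
def Bal2 (V : Finset (ZMod L)) (a1 a2 : ℤ) : Prop :=
  ∀ s t : ℤ, s < t → ((s + 1 : ℤ) : ZMod L) ∉ V → (t : ZMod L) ∈ V →
    a2 * ((t - s) - (cnt V t - cnt V s) - 1) < a1 * (cnt V t - cnt V s)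

lemma bal_rev {V : Finset (ZMod L)} {a1 a2 : ℤ} (h : Bal2 V a1 a2) : Bal (ng Vᶜ) a2 a1 := by
  intro s t hst hs ht
  have h1 : ((-s - 1 : ℤ) : ZMod L) ∈ V := by
    rw [mem_ng] at hs; simp at hs
    convert hs using 1; push_cast; ring
  have h2 : ((-t - 1 + 1 : ℤ) : ZMod L) ∉ V := by
    rw [mem_ng] at ht; simp at ht
    convert ht using 2; push_cast; ring
  have := h (-t - 1) (-s - 1) (by omega) h2 h1
  rw [cnt_rev, cnt_rev]
  have e1 : (-s - 1 - (-t - 1)) = t - s := by ring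
  rw [e1] at this
  convert this using 2 <;> ring

/-- The Christoffel word. -/
def chr (L a2 : ℕ) [NeZero L] : Finset (ZMod L) :=
  Finset.univ.filter fun x => (x.val * a2) % L < a2

lemma mem_chr {a2 : ℕ} {k : ℤ} : (k : ZMod L) ∈ chr L a2 ↔ (k * a2) % (L : ℤ) < a2 := by
  unfold chr
  simp only [Finset.mem_filter, Finset.mem_univ, true_and]
  have : (((((k : ZMod L)).val * a2) % L : ℕ) : ℤ) = (k * a2) % (L : ℤ) := by
    push_cast
    rw [ZMod.val_intCast, Int.mul_emod, Int.emod_emod, ← Int.mul_emod]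
  rw [← this]; norm_cast

lemma cnt_chr {a2 : ℕ} (h : a2 ≤ L) (k : ℤ) : cnt (chr L a2) k = (k * a2) / (L : ℤ) := by
  have hL : (0 : ℤ) < L := by exact_mod_cast Nat.pos_of_ne_zero (NeZero.ne L)
  have h' : (a2 : ℤ) ≤ L := by exact_mod_cast h
  have := const_of_step (fun k => cnt (chr L a2) k - (k * a2) / (L : ℤ)) (by
    intro k
    have hd := Int.emod_add_mul_ediv (k * a2) L
    have h0 := Int.emod_nonneg (k * a2) hL.ne'
    have h1 := Int.emod_lt_of_pos (k * a2) hL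
    have e : (k - 1) * (a2 : ℤ) = (k * a2) - a2 := by ring
    by_cases hk : (k : ZMod L) ∈ chr L a2
    · have h2 := cnt_mem hk
      rw [mem_chr] at hk
      have : ((k - 1) * (a2 : ℤ)) / L = (k * a2) / L - 1 := by
        rw [e]
        apply Int.ediv_eq_iff_of_pos hL |>.2
        constructor <;> nlinarith
      linarith
    · have h2 := cnt_not hk
      rw [mem_chr, not_lt] at hk
      have : ((k - 1) * (a2 : ℤ)) / L = (k * a2) / L := by
        rw [e]
        apply Int.ediv_eq_iff_of_pos hL |>.2
        constructor <;> nlinarith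
      linarith) k
  simp [cnt_zero] at this
  linarith

lemma chr_card {a2 : ℕ} (h : a2 ≤ L) : (chr L a2).card = a2 := by
  have h1 := cnt_period (chr L a2) 0
  rw [cnt_zero, cnt_chr h] at h1
  have hL : (0 : ℤ) < L := by exact_mod_cast Nat.pos_of_ne_zero (NeZero.ne L)
  rw [zero_add, zero_add, Int.mul_ediv_cancel_left _ hL.ne'] at h1
  exact_mod_cast h1.symm

lemma chr_facts {a2 : ℕ} (h : a2 ≤ L) {s t : ℤ} (hs : ((s + 1 : ℤ) : ZMod L) ∉ chr L a2)
    (ht : (t : ZMod L) ∈ chr L a2) :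
    L * cnt (chr L a2) s ≤ s * a2 ∧ (s + 1) * a2 < L * cnt (chr L a2) s + L ∧
    L * cnt (chr L a2) t ≤ t * a2 ∧ (t - 1) * a2 < L * cnt (chr L a2) t := by
  have hL : (0 : ℤ) < L := by exact_mod_cast Nat.pos_of_ne_zero (NeZero.ne L)
  have h1 := cnt_not hs
  have h2 := cnt_mem ht
  simp only [add_sub_cancel_right] at h1
  have f : ∀ k, L * cnt (chr L a2) k ≤ k * a2 ∧ k * a2 < L * cnt (chr L a2) k + L := by
    intro k
    rw [cnt_chr h]
    have hd := Int.emod_add_mul_ediv (k * a2) L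
    have h0 := Int.emod_nonneg (k * a2) hL.ne'
    have h1 := Int.emod_lt_of_pos (k * a2) hL
    constructor <;> linarith
  refine ⟨(f s).1, ?_, (f t).1, ?_⟩
  · rw [← h1]; exact (f _).2
  · rw [h2]; have := (f (t - 1)).2; linarith

lemma chr_bal {a1 a2 : ℕ} (h : L = a1 + a2) : Bal (chr L a2) a1 a2 := by
  intro s t hst hs ht
  obtain ⟨h1, h2, h3, h4⟩ := chr_facts (by omega) hs ht
  have e : (L : ℤ) = a1 + a2 := by exact_mod_cast h
  rw [e] at h1 h2 h3 h4
  linarith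

lemma chr_bal2 {a1 a2 : ℕ} (h : L = a1 + a2) : Bal2 (chr L a2) a1 a2 := by
  intro s t hst hs ht
  obtain ⟨h1, h2, h3, h4⟩ := chr_facts (by omega) hs ht
  have e : (L : ℤ) = a1 + a2 := by exact_mod_cast h
  rw [e] at h1 h2 h3 h4
  linarith

end

noncomputable section
set_option linter.unusedSectionVars false

/-- Laurent polynomials in one variable. -/
abbrev Lam := LaurentPolynomial ℤ

open LaurentPolynomial

lemma coeff_T (t t' : ℤ) : (T t : Lam).coeff t' = if t = t' then 1 else 0 := by
  change (AddMonoidAlgebra.single t (1:ℤ)).coeff t' = _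
  rw [AddMonoidAlgebra.coeff_single, Finsupp.single_apply]

lemma coeff_T_mul (a t : ℤ) (b : Lam) : (T a * b : Lam).coeff t = b.coeff (t - a) := by
  change (AddMonoidAlgebra.single a (1:ℤ) * b).coeff t = _
  rw [AddMonoidAlgebra.coeff_single_mul_apply, one_mul]
  congr 1; ring

lemma coeff_sumL {ι : Type*} (s : Finset ι) (b : ι → Lam) (t : ℤ) :
    (∑ i ∈ s, b i).coeff t = ∑ i ∈ s, (b i).coeff t := by
  simp only [AddMonoidAlgebra.coeff_sum, Finsupp.coe_finsetSum, Finset.sum_apply]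

lemma coeff_addL (a b : Lam) (t : ℤ) : (a + b).coeff t = a.coeff t + b.coeff t := by
  simp only [AddMonoidAlgebra.coeff_add, Finsupp.coe_add, Pi.add_apply]

lemma coeff_subL (a b : Lam) (t : ℤ) : (a - b).coeff t = a.coeff t - b.coeff t := by
  simp only [AddMonoidAlgebra.coeff_sub, Finsupp.coe_sub, Pi.sub_apply]

/-- Row half of the greedy conditions. -/
def GR (r : ℕ) (a1 a2 : ℤ) (g : ℤ → ℤ → ℤ) : Prop :=
  ∀ k : ℕ, ∃ b : Lam, (∀ t, g (-k) t = ((1 + T r) ^ k * b).coeff t) ∧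
    ∀ t, 0 ≤ t * a1 + k * a2 → b.coeff t = if (k : ℤ) = a1 ∧ t = -a2 then 1 else 0

lemma low_step {r : ℕ} (hr : 1 ≤ r) (b : Lam) (t : ℤ)
    (h : ∀ t' < t, ((1 + T r) * b : Lam).coeff t' = 0) : ∀ t' < t, b.coeff t' = 0 := by
  have hc : ∀ t, ((1 + T r) * b : Lam).coeff t = b.coeff t + b.coeff (t - r) := by
    intro t; rw [add_mul, one_mul, coeff_addL, coeff_T_mul]
  by_contra hcon
  push Not at hcon
  obtain ⟨t1, ht1, h1⟩ := hcon
  have hne : b.coeff.support.Nonempty := ⟨t1, by simpa using h1⟩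
  have hm := b.coeff.support.min'_mem hne
  have hle := b.coeff.support.min'_le t1 (by simpa using h1)
  set m := b.coeff.support.min' hne
  have h2 := h m (by omega)
  rw [hc] at h2
  have h3 : b.coeff (m - r) = 0 := by
    by_contra h3
    have := b.coeff.support.min'_le (m - r) (by simpa using h3)
    omega
  rw [h3, add_zero] at h2
  simp at hm
  exact hm h2

lemma low_pow {r : ℕ} (hr : 1 ≤ r) (k : ℕ) (t : ℤ) : ∀ b : Lam,
    (∀ t' < t, ((1 + T r) ^ k * b : Lam).coeff t' = 0) →
    ((1 + T r) ^ k * b : Lam).coeff t = b.coeff t ∧ ∀ t' < t, b.coeff t' = 0 := by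
  induction k with
  | zero => intro b h; simpa using h
  | succ k ih =>
    intro b h
    rw [pow_succ, mul_assoc] at h ⊢
    obtain ⟨h1, h2⟩ := ih _ h
    have h3 := low_step hr b t h2
    rw [h1]
    refine ⟨?_, h3⟩
    rw [add_mul, one_mul, coeff_addL, coeff_T_mul, h3 (t - r) (by omega), add_zero]

/-- Laurent polynomials in two variables. -/
abbrev R0 := AddMonoidAlgebra ℤ (ℤ × ℤ)

/-- All greedy conditions. -/
def Greedy (r : ℕ) (a1 a2 : ℤ) (g : ℤ → ℤ → ℤ) : Prop :=
  GR r a1 a2 g ∧ GR r a2 a1 (fun s t => g t s) ∧ ∀ s t, 0 < s → 0 < t → g s t = 0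

lemma GR_zero {r : ℕ} (hr : 1 ≤ r) {a1 a2 : ℤ} {g h : ℤ → ℤ → ℤ} (hg : GR r a1 a2 g)
    (hh : GR r a1 a2 h) (k : ℕ) (t : ℤ) (ht : 0 ≤ t * a1 + k * a2)
    (hlow : ∀ t' < t, g (-k) t' = h (-k) t') : g (-k) t = h (-k) t := by
  obtain ⟨b, hb1, hb2⟩ := hg k
  obtain ⟨b', hb1', hb2'⟩ := hh k
  have := (low_pow hr k t (b - b') (by
    intro t' ht'
    rw [mul_sub, coeff_subL, ← hb1, ← hb1', hlow t' ht', sub_self])).1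
  rw [mul_sub, coeff_subL, coeff_subL, ← hb1, ← hb1', hb2 t ht, hb2' t ht, sub_self] at this
  linarith

lemma greedy_unique {r : ℕ} (hr : 1 ≤ r) {a1 a2 : ℤ} (ha1 : 0 < a1) (ha2 : 0 < a2) {f g : R0}
    (hf : Greedy r a1 a2 (fun s t => f.coeff (s, t)))
    (hg : Greedy r a1 a2 (fun s t => g.coeff (s, t))) : f = g := by
  by_contra hne
  have hd : (f - g).coeff.support.Nonempty := by
    rw [Finsupp.support_nonempty_iff]
    intro h
    apply hne
    rw [← sub_eq_zero]
    exact AddMonoidAlgebra.coeff_eq_zero.1 h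
  obtain ⟨⟨s, t⟩, hst, hmin⟩ := Finset.exists_min_image _ (fun p : ℤ × ℤ => p.1 + p.2) hd
  have hm : ∀ p : ℤ × ℤ, p.1 + p.2 < s + t → f.coeff p = g.coeff p := by
    intro p hp
    by_contra h
    have := hmin p (by
      simp only [Finsupp.mem_support_iff, AddMonoidAlgebra.coeff_sub, Finsupp.coe_sub, Pi.sub_apply]
      exact sub_ne_zero.2 h)
    simp only at this
    omega
  have hst' : f.coeff (s, t) ≠ g.coeff (s, t) := by
    simp only [Finsupp.mem_support_iff, AddMonoidAlgebra.coeff_sub, Finsupp.coe_sub, Pi.sub_apply] at hst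
    exact sub_ne_zero.1 hst
  apply hst'
  obtain ⟨f1, f2, f3⟩ := hf
  obtain ⟨g1, g2, g3⟩ := hg
  rcases le_total (s * a2) (t * a1) with h | h
  · rcases le_or_gt s 0 with hs | hs
    · obtain ⟨k, rfl⟩ : ∃ k : ℕ, s = -k := ⟨(-s).toNat, by omega⟩
      exact GR_zero hr f1 g1 k t (by linarith) (fun t' ht' => hm (_, _) (by simp; omega))
    · have : 0 < t := by
        by_contra ht
        nlinarith
      exact (f3 s t hs this).trans (g3 s t hs this).symm
  · rcases le_or_gt t 0 with hs | hs
    · obtain ⟨k, rfl⟩ : ∃ k : ℕ, t = -k := ⟨(-t).toNat, by omega⟩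
      exact GR_zero hr f2 g2 k s (by linarith) (fun t' ht' => hm (_, _) (by simp; omega))
    · have : 0 < s := by
        by_contra ht
        nlinarith
      exact (f3 s t this hs).trans (g3 s t this hs).symm

lemma sum_split {A : Type*} [CommRing A] {ι : Type*} [DecidableEq ι] (x : A) (H Fr : Finset ι)
    (hF : Fr ⊆ H) (p : Finset ι → Prop) (hp : ∀ S, p S ↔ p (S \ Fr)) :
    ∑ S ∈ H.powerset.filter p, x ^ S.card =
      (1 + x) ^ Fr.card * ∑ S ∈ (H.powerset.filter fun S => p S ∧ Disjoint S Fr), x ^ S.card := by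
  have h1 : (1 + x) ^ Fr.card = ∑ U ∈ Fr.powerset, x ^ U.card := by
    rw [add_comm, ← Finset.sum_pow_mul_eq_add_pow]; simp
  rw [h1, Finset.sum_mul_sum, ← Finset.sum_product']
  refine Finset.sum_nbij' (fun S => (S ∩ Fr, S \ Fr)) (fun q => q.1 ∪ q.2) ?_ ?_ ?_ ?_ ?_
  · intro S hS
    simp only [Finset.mem_filter, Finset.mem_powerset] at hS
    simp only [Finset.mem_product, Finset.mem_filter, Finset.mem_powerset]
    exact ⟨Finset.inter_subset_right, Finset.sdiff_subset.trans hS.1, (hp S).1 hS.2, Finset.sdiff_disjoint⟩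
  · rintro ⟨U, S⟩ hS
    simp only [Finset.mem_product, Finset.mem_filter, Finset.mem_powerset] at hS
    simp only [Finset.mem_filter, Finset.mem_powerset]
    refine ⟨Finset.union_subset (hS.1.trans hF) hS.2.1, ?_⟩
    rw [hp, Finset.union_sdiff_distrib, Finset.sdiff_eq_empty_iff_subset.2 hS.1, Finset.empty_union,
      Finset.sdiff_eq_self_of_disjoint hS.2.2.2]
    exact hS.2.2.1
  · intro S hS
    ext x; simp only [Finset.mem_union, Finset.mem_inter, Finset.mem_sdiff]; tauto
  · rintro ⟨U, S⟩ hS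
    simp only [Finset.mem_product, Finset.mem_filter, Finset.mem_powerset] at hS
    have hd := Finset.disjoint_left.1 hS.2.2.2
    ext x
    · simp only [Finset.mem_inter, Finset.mem_union]
      constructor
      · rintro ⟨h | h, h'⟩
        · exact h
        · exact absurd h' (hd h)
      · intro h; exact ⟨Or.inl h, hS.1 h⟩
    · simp only [Finset.mem_sdiff, Finset.mem_union]
      constructor
      · rintro ⟨h | h, h'⟩
        · exact absurd (hS.1 h) h'
        · exact h
      · intro h; exact ⟨Or.inr h, hd h⟩
  · intro S hS
    rw [← pow_add, Finset.card_inter_add_card_sdiff]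

variable {L : ℕ} [NeZero L]

/-- Compatible pairs. -/
def PR (r : ℕ) (V : Finset (ZMod L)) : Finset (Finset (ZMod L) × Finset (ZMod L)) :=
  (Vᶜ.powerset ×ˢ V.powerset).filter fun p => Comp r V p.1 p.2

lemma mem_PR {r : ℕ} {V : Finset (ZMod L)} {p : Finset (ZMod L) × Finset (ZMod L)} :
    p ∈ PR r V ↔ (p.1 ⊆ Vᶜ ∧ p.2 ⊆ V) ∧ Comp r V p.1 p.2 := by
  simp [PR]

/-- Coefficients of the greedy element. -/
def Pc (r : ℕ) (V : Finset (ZMod L)) (a1 a2 s t : ℤ) : ℤ :=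
  ∑ p ∈ PR r V, if -a1 + r * p.2.card = s ∧ -a2 + r * p.1.card = t then 1 else 0

lemma Pc_rev (r : ℕ) (V : Finset (ZMod L)) (a1 a2 s t : ℤ) :
    Pc r (ng Vᶜ) a2 a1 t s = Pc r V a1 a2 s t := by
  unfold Pc
  refine Finset.sum_nbij' (fun p => (ng p.2, ng p.1)) (fun p => (ng p.2, ng p.1)) ?_ ?_ ?_ ?_ ?_
  · intro p hp
    rw [mem_PR] at hp ⊢
    refine ⟨⟨?_, ?_⟩, ?_⟩
    · intro x hx
      rw [mem_ng] at hx
      simpa [mem_ng] using hp.1.2 hx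
    · intro x hx
      rw [mem_ng] at hx
      simpa [mem_ng] using hp.1.1 hx
    · rw [comp_rev, ng_ng, ng_ng]; exact hp.2
  · intro p hp
    rw [mem_PR] at hp ⊢
    refine ⟨⟨?_, ?_⟩, ?_⟩
    · intro x hx
      rw [mem_ng] at hx
      simpa [mem_ng] using hp.1.2 hx
    · intro x hx
      rw [mem_ng] at hx
      simpa [mem_ng] using hp.1.1 hx
    · rw [← comp_rev]; exact hp.2
  · intro p _; simp [ng_ng]
  · intro p _; simp [ng_ng]
  · intro p _
    simp only [ng_card]
    congr 1
    exact propext and_comm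

lemma Pc_row {r : ℕ} (hr : 1 ≤ r) {V : Finset (ZMod L)} {a1 a2 : ℕ} (hL : L = a1 + a2)
    (hV : V.card = a2) (hb : Bal V a1 a2) : GR r a1 a2 (Pc r V a1 a2) := by
  intro k
  have hLz : (L : ℤ) = a1 + a2 := by exact_mod_cast hL
  set Q := V.powerset.filter fun S2 => (-(a1:ℤ) + r * S2.card = -k) with hQ
  have hQd : ∀ S2 ∈ Q, S2 ⊆ V ∧ (L:ℤ) - V.card - r * S2.card = k := by
    intro S2 h
    simp only [hQ, Finset.mem_filter, Finset.mem_powerset] at h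
    refine ⟨h.1, ?_⟩
    rw [hV, hLz]; linarith [h.2]
  refine ⟨∑ S2 ∈ Q, ∑ S1 ∈ Vᶜ.powerset.filter
    (fun S1 => Comp r V S1 S2 ∧ Disjoint S1 (free r V S2)), T (-a2 + r * S1.card), ?_, ?_⟩
  · intro t
    have e1 : ∀ m : ℕ, (T (-a2 + r * m) : Lam) = T (-a2) * (T r) ^ m := by
      intro m; rw [T_add, T_pow, mul_comm (r:ℤ)]
    have e2 : ((1 + T r) ^ k * ∑ S2 ∈ Q, ∑ S1 ∈ Vᶜ.powerset.filter
        (fun S1 => Comp r V S1 S2 ∧ Disjoint S1 (free r V S2)), T (-a2 + r * S1.card) : Lam) =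
        ∑ S2 ∈ Q, ∑ S1 ∈ Vᶜ.powerset.filter (fun S1 => Comp r V S1 S2), T (-a2 + r * S1.card) := by
      rw [Finset.mul_sum]
      refine Finset.sum_congr rfl fun S2 h2 => ?_
      obtain ⟨h2V, hk⟩ := hQd S2 h2
      simp only [e1]
      rw [← Finset.mul_sum, ← Finset.mul_sum]
      have hc : (free r V S2).card = k := by
        have := free_card (r := r) h2V (by rw [hk]; positivity)
        rw [hk] at this; exact_mod_cast this
      rw [sum_split (T r : Lam) Vᶜ (free r V S2) (by
        intro x hx
        simp only [free, Finset.mem_filter] at hx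
        simpa using hx.2.1) (fun S1 => Comp r V S1 S2) (fun S1 => comp_iff_sdiff h2V), hc]
      ring
    rw [e2]
    simp only [coeff_sumL, coeff_T]
    unfold Pc PR
    rw [hQ, Finset.sum_filter, Finset.sum_filter, Finset.sum_product_right]
    refine Finset.sum_congr rfl fun S2 _ => ?_
    rw [Finset.sum_filter]
    split_ifs with h
    · refine Finset.sum_congr rfl fun S1 _ => ?_
      simp [h]
    · refine Finset.sum_eq_zero fun S1 _ => ?_
      simp [h]
  · intro t ht
    simp only [coeff_sumL, coeff_T]
    have key : ∀ S2 ∈ Q, ∀ S1 ∈ Vᶜ.powerset.filter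
        (fun S1 => Comp r V S1 S2 ∧ Disjoint S1 (free r V S2)), -(a2:ℤ) + r * S1.card = t →
        S1 = ∅ ∧ S2 = ∅ := by
      intro S2 h2 S1 h1 h
      obtain ⟨h2V, hk⟩ := hQd S2 h2
      simp only [Finset.mem_filter, Finset.mem_powerset] at h1
      have := support_bound hr (S1 := S1) (by positivity) (by
        rw [Finset.disjoint_left]; intro x hx; simpa using h1.1 hx) h2V (by rw [hk]; positivity) hb
        h1.2.2 h1.2.1
      rcases this with h3 | h3
      · simpa using h3
      · exfalso
        rw [hV, hLz] at hk
        have e1 : (r : ℤ) * S1.card = t + a2 := by linarith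
        have e2 : (r : ℤ) * S2.card = a1 - k := by linarith
        rw [e1, e2] at h3
        nlinarith
    split_ifs with hc
    · obtain ⟨hk, rfl⟩ := hc
      have hk' : k = a1 := by exact_mod_cast hk
      have hQe : ∅ ∈ Q := by simp [hQ, hk']
      rw [Finset.sum_eq_single_of_mem ∅ hQe]
      · rw [Finset.sum_eq_single_of_mem ∅]
        · simp
        · simp [Comp]
        · intro S1 h1 hne
          rw [if_neg]
          intro h
          exact hne (key ∅ hQe S1 h1 h).1
      · intro S2 h2 hne
        refine Finset.sum_eq_zero fun S1 h1 => ?_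
        rw [if_neg]
        intro h
        exact hne (key S2 h2 S1 h1 h).2
    · refine Finset.sum_eq_zero fun S2 h2 => Finset.sum_eq_zero fun S1 h1 => ?_
      rw [if_neg]
      intro h
      obtain ⟨rfl, rfl⟩ := key S2 h2 S1 h1 h
      apply hc
      obtain ⟨-, hk⟩ := hQd ∅ h2
      rw [hV, hLz] at hk
      simp at hk h
      exact ⟨by linarith, by linarith⟩

lemma Pc_greedy {r : ℕ} (hr : 1 ≤ r) {V : Finset (ZMod L)} {a1 a2 : ℕ} (hL : L = a1 + a2)
    (hV : V.card = a2) (hb : Bal V a1 a2) (hb2 : Bal2 V a1 a2) :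
    Greedy r a1 a2 (Pc r V a1 a2) := by
  refine ⟨Pc_row hr hL hV hb, ?_, ?_⟩
  · have := Pc_row (V := ng Vᶜ) hr (a1 := a2) (a2 := a1) (by omega) (by
      rw [ng_card, Finset.card_compl, ZMod.card, hV]; omega) (bal_rev hb2)
    convert this using 3
    rw [Pc_rev]
  · intro s t hs ht
    refine Finset.sum_eq_zero fun p hp => ?_
    rw [if_neg]
    rintro ⟨h1, h2⟩
    rw [mem_PR] at hp
    refine not_comp_of_large ?_ ?_ hp.2
    · have e : (L : ℤ) = a1 + a2 := by exact_mod_cast hL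
      rw [hV]; linarith
    · rw [hV]; linarith

/-- Any greedy element has an explicit positive expansion. -/
lemma greedy_expansion {r : ℕ} (hr : 1 ≤ r) {a1 a2 : ℕ} (ha1 : 0 < a1) (ha2 : 0 < a2) {f : R0}
    (hf : Greedy r a1 a2 (fun s t => f.coeff (s, t))) :
    ∀ p, 0 ≤ f.coeff p := by
  have : NeZero (a1 + a2) := ⟨by omega⟩
  set V := chr (a1 + a2) a2
  set P : R0 := ∑ p ∈ PR r V, AddMonoidAlgebra.single
    (-(a1:ℤ) + r * p.2.card, -(a2:ℤ) + r * p.1.card) 1 with hP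
  have hc : ∀ s t, P.coeff (s, t) = Pc r V a1 a2 s t := by
    intro s t
    rw [hP]
    simp only [AddMonoidAlgebra.coeff_sum, Finsupp.coe_finsetSum, Finset.sum_apply,
      AddMonoidAlgebra.coeff_single, Finsupp.single_apply, Prod.mk.injEq]
    rfl
  have hg := Pc_greedy (r := r) hr (V := V) (a1 := a1) (a2 := a2) rfl (chr_card (by omega))
    (chr_bal rfl) (chr_bal2 rfl)
  have : f = P := greedy_unique hr (by exact_mod_cast ha1) (by exact_mod_cast ha2) hf (by
    simp only [hc]; exact hg)
  rintro ⟨s, t⟩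
  rw [this, hc]
  exact Finset.sum_nonneg fun _ _ => by split_ifs <;> simp

end

noncomputable section

/-- Degrees bounded by `d`. -/
def DegLe (φ : ℤ × ℤ →+ ℤ) (f : R0) (d : ℤ) : Prop := ∀ p, f.coeff p ≠ 0 → φ p ≤ d

/-- Unique top term, with coefficient one. -/
def Top (φ : ℤ × ℤ →+ ℤ) (f : R0) (e : ℤ × ℤ) : Prop :=
  DegLe φ f (φ e) ∧ ∀ p, φ p = φ e → f.coeff p = if p = e then 1 else 0

lemma coeff_add0 (f g : R0) (p) : (f + g).coeff p = f.coeff p + g.coeff p := by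
  simp only [AddMonoidAlgebra.coeff_add, Finsupp.coe_add, Pi.add_apply]

lemma coeff_sub0 (f g : R0) (p) : (f - g).coeff p = f.coeff p - g.coeff p := by
  simp only [AddMonoidAlgebra.coeff_sub, Finsupp.coe_sub, Pi.sub_apply]

lemma coeff_single0 (q p : ℤ × ℤ) (a : ℤ) :
    (AddMonoidAlgebra.single q a : R0).coeff p = if q = p then a else 0 := by
  rw [AddMonoidAlgebra.coeff_single, Finsupp.single_apply]

lemma coeff_one0 (p : ℤ × ℤ) : (1 : R0).coeff p = if p = 0 then 1 else 0 := by
  rw [AddMonoidAlgebra.one_def, coeff_single0]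
  simp only [eq_comm]

variable {φ : ℤ × ℤ →+ ℤ}

lemma DegLe.mono {f : R0} {d d' : ℤ} (h : DegLe φ f d) (hd : d ≤ d') : DegLe φ f d' :=
  fun p hp => (h p hp).trans hd

lemma DegLe.add {f g : R0} {d : ℤ} (h : DegLe φ f d) (h' : DegLe φ g d) : DegLe φ (f + g) d := by
  intro p hp
  rw [coeff_add0] at hp
  by_cases h1 : f.coeff p = 0
  · exact h' p (by simpa [h1] using hp)
  · exact h p h1

lemma DegLe.mul {f g : R0} {d d' : ℤ} (h : DegLe φ f d) (h' : DegLe φ g d') :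
    DegLe φ (f * g) (d + d') := by
  intro p hp
  have := AddMonoidAlgebra.support_coeff_mul_subset f g (Finsupp.mem_support_iff.2 hp)
  obtain ⟨a, ha, b, hb, rfl⟩ := Finset.mem_add.1 this
  rw [map_add]
  exact add_le_add (h a (Finsupp.mem_support_iff.1 ha)) (h' b (Finsupp.mem_support_iff.1 hb))

lemma DegLe.one : DegLe φ 1 0 := by
  intro p hp
  rw [coeff_one0] at hp
  have : p = 0 := by by_contra h; simp [h] at hp
  simp [this]

lemma DegLe.pow {f : R0} {d : ℤ} (h : DegLe φ f d) (k : ℕ) : DegLe φ (f ^ k) (k * d) := by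
  induction k with
  | zero => simpa using DegLe.one
  | succ k ih => rw [pow_succ]; exact (ih.mul h).mono (by push_cast; linarith)

lemma DegLe.coeff {f : R0} {d : ℤ} (h : DegLe φ f d) {p} (hp : d < φ p) : f.coeff p = 0 := by
  by_contra h'
  exact absurd (h p h') (by omega)

lemma Top.mul_coeff {f g : R0} {e : ℤ × ℤ} {d : ℤ} (h : Top φ f e) (h' : DegLe φ g d) {p}
    (hp : φ p = d) : (f * g).coeff (e + p) = g.coeff p := by
  have h1 : DegLe φ (f - AddMonoidAlgebra.single e 1) (φ e - 1) := by
    intro q hq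
    rw [coeff_sub0, coeff_single0] at hq
    by_contra hlt
    rcases lt_or_eq_of_le (show φ e ≤ φ q by omega) with h2 | h2
    · rw [h.1.coeff h2] at hq
      have : e ≠ q := by rintro rfl; exact lt_irrefl _ h2
      simp [this] at hq
    · rw [h.2 q h2.symm] at hq
      simp [eq_comm] at hq
  have h2 : f * g = AddMonoidAlgebra.single e 1 * g + (f - AddMonoidAlgebra.single e 1) * g := by ring
  rw [h2, coeff_add0, (h1.mul h').coeff (by rw [map_add]; omega),
    AddMonoidAlgebra.coeff_single_mul_apply]
  simp

lemma Top.degLe_right {f g : R0} {e : ℤ × ℤ} {d : ℤ} (h : Top φ f e)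
    (h' : DegLe φ (f * g) d) : DegLe φ g (d - φ e) := by
  by_contra hcon
  unfold DegLe at hcon
  push Not at hcon
  obtain ⟨q, hq, hq2⟩ := hcon
  obtain ⟨m, hm, hmax⟩ := Finset.exists_max_image g.coeff.support φ ⟨q, Finsupp.mem_support_iff.2 hq⟩
  have h1 : DegLe φ g (φ m) := fun p hp => hmax p (Finsupp.mem_support_iff.2 hp)
  have h2 := h.mul_coeff h1 rfl
  have h3 := hmax q (Finsupp.mem_support_iff.2 hq)
  rw [h'.coeff (by rw [map_add]; omega)] at h2
  exact Finsupp.mem_support_iff.1 hm h2.symm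

lemma Top.mul {f g : R0} {e e' : ℤ × ℤ} (h : Top φ f e) (h' : Top φ g e') :
    Top φ (f * g) (e + e') := by
  refine ⟨by rw [map_add]; exact h.1.mul h'.1, fun p hp => ?_⟩
  rw [map_add] at hp
  have e1 : p = e + (p - e) := by abel
  rw [e1, h.mul_coeff h'.1 (by rw [map_sub]; omega), h'.2 _ (by rw [map_sub]; omega)]
  simp only [add_right_inj]

lemma Top.div {f g : R0} {e e' : ℤ × ℤ} (h : Top φ f e) (h' : Top φ (f * g) e') :
    Top φ g (e' - e) := by
  have h1 := h.degLe_right h'.1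
  rw [← map_sub] at h1
  refine ⟨h1, fun p hp => ?_⟩
  rw [← h.mul_coeff h1 hp, h'.2 _ (by rw [map_add, hp, map_sub]; ring)]
  congr 1
  rw [eq_sub_iff_add_eq, add_comm]

lemma Top.one : Top φ 1 0 := by
  refine ⟨by simpa using DegLe.one, fun p _ => coeff_one0 p⟩

lemma Top.single (e : ℤ × ℤ) : Top φ (AddMonoidAlgebra.single e 1) e := by
  refine ⟨fun p hp => ?_, fun p _ => ?_⟩
  · rw [coeff_single0] at hp
    have : e = p := by by_contra h; simp [h] at hp
    rw [this]
  · rw [coeff_single0]; simp only [eq_comm]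

lemma Top.pow {f : R0} {e : ℤ × ℤ} (h : Top φ f e) (k : ℕ) : Top φ (f ^ k) (k • e) := by
  induction k with
  | zero => simpa using Top.one
  | succ k ih => rw [pow_succ, succ_nsmul]; exact ih.mul h

lemma Top.add_low {f g : R0} {e : ℤ × ℤ} {d : ℤ} (h : Top φ f e) (h' : DegLe φ g d) (hd : d < φ e) :
    Top φ (f + g) e := by
  refine ⟨h.1.add (h'.mono hd.le), fun p hp => ?_⟩
  rw [coeff_add0, h.2 p hp, h'.coeff (by omega), add_zero]

/-- The auxiliary polynomial used in the Laurent recurrence. -/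
def qq (r : ℕ) (z : R0) : R0 := -(z ^ (r - 1) * ∑ i ∈ Finset.range r, (1 + z ^ r) ^ i)

/-- The cluster variables as Laurent polynomials. -/
def yy (r : ℕ) : ℕ → R0
  | 0 => (AddMonoidAlgebra.single (1, 0) 1 ^ r + 1) * AddMonoidAlgebra.single (0, -1) 1
  | 1 => AddMonoidAlgebra.single (1, 0) 1
  | 2 => AddMonoidAlgebra.single (0, 1) 1
  | 3 => (AddMonoidAlgebra.single (0, 1) 1 ^ r + 1) * AddMonoidAlgebra.single (-1, 0) 1
  | n + 4 => yy r n * yy r (n + 3) ^ r + qq r (yy r (n + 2))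

lemma qq_mul {r : ℕ} (hr : 1 ≤ r) (z : R0) : qq r z * z = 1 - (1 + z ^ r) ^ r := by
  have h := geom_sum_mul (1 + z ^ r) r
  have e : z ^ (r - 1) * z = z ^ r := by rw [← pow_succ]; congr 1; omega
  unfold qq
  calc _ = -((∑ i ∈ Finset.range r, (1 + z ^ r) ^ i) * (z ^ (r - 1) * z)) := by ring
    _ = -((∑ i ∈ Finset.range r, (1 + z ^ r) ^ i) * (1 + z ^ r - 1)) := by rw [e]; ring
    _ = _ := by rw [h]; ring

lemma yy_rel {r : ℕ} (hr : 1 ≤ r) : ∀ n, yy r (n + 2) * yy r n = yy r (n + 1) ^ r + 1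
  | 0 => by
    simp only [yy]
    have : (AddMonoidAlgebra.single (0, 1) 1 * AddMonoidAlgebra.single (0, -1) 1 : R0) = 1 := by
      rw [AddMonoidAlgebra.single_mul_single]; rfl
    linear_combination ((AddMonoidAlgebra.single (1, 0) 1 : R0) ^ r + 1) * this
  | 1 => by
    simp only [yy]
    have : (AddMonoidAlgebra.single (-1, 0) 1 * AddMonoidAlgebra.single (1, 0) 1 : R0) = 1 := by
      rw [AddMonoidAlgebra.single_mul_single]; rfl
    linear_combination ((AddMonoidAlgebra.single (0, 1) 1 : R0) ^ r + 1) * this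
  | n + 2 => by
    have h1 := yy_rel hr n
    have h2 := yy_rel hr (n + 1)
    have h3 := qq_mul hr (yy r (n + 2))
    have e : yy r (n + 2 + 2) = yy r n * yy r (n + 3) ^ r + qq r (yy r (n + 2)) := rfl
    rw [e]
    have h4 : (1 + yy r (n + 2) ^ r) ^ r = yy r (n + 3) ^ r * yy r (n + 1) ^ r := by
      rw [← mul_pow, add_comm, ← h2]
    rw [h4] at h3
    change _ = yy r (n + 3) ^ r + 1
    linear_combination yy r (n + 3) ^ r * h1 + h3

lemma c_pos {r : ℕ} (hr : 2 ≤ r) (n : ℕ) : 0 ≤ c r (n + 1) ∧ c r (n + 1) < c r (n + 2) := by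
  induction n with
  | zero => simp [c]
  | succ n ih =>
    refine ⟨by linarith [ih.1, ih.2], ?_⟩
    have e : c r (n + 1 + 2) = r * c r (n + 2) - c r (n + 1) := rfl
    have hr' : (2 : ℤ) ≤ r := by exact_mod_cast hr
    rw [e]
    show c r (n + 2) < _
    nlinarith [ih.1, ih.2]

/-- The weight functional. -/
def wt (a b : ℤ) : ℤ × ℤ →+ ℤ where
  toFun p := a * p.1 + b * p.2
  map_zero' := by simp
  map_add' p q := by simp; ring

lemma wt_apply (a b : ℤ) (p : ℤ × ℤ) : wt a b p = a * p.1 + b * p.2 := rfl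

lemma wt_e {r : ℕ} (N : ℕ) : ∀ j i : ℕ, j + i = N + 1 →
    wt (c r (N + 1)) (c r N) (-c r j, c r (j + 1)) = c r i
  | 0, i, h => by
    obtain rfl : i = N + 1 := by omega
    simp [wt_apply, c]
  | 1, i, h => by
    obtain rfl : i = N := by omega
    simp [wt_apply, c]
  | j + 2, i, h => by
    have h1 := wt_e (r := r) N j (i + 2) (by omega)
    have h2 := wt_e (r := r) N (j + 1) (i + 1) (by omega)
    simp only [wt_apply, c] at h1 h2 ⊢
    linear_combination r * h2 - h1

lemma top_yy {r : ℕ} (hr : 2 ≤ r) (N : ℕ) : ∀ j, j ≤ N →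
    Top (wt (c r (N + 1)) (c r N)) (yy r (j + 1)) (-c r j, c r (j + 1))
  | 0, _ => by
    have := Top.single (φ := wt (c r (N + 1)) (c r N)) (1, 0)
    simpa [yy, c] using this
  | 1, _ => by
    have := Top.single (φ := wt (c r (N + 1)) (c r N)) (0, 1)
    simpa [yy, c] using this
  | j + 2, h => by
    have h1 := top_yy hr N j (by omega)
    have h2 := top_yy hr N (j + 1) (by omega)
    obtain ⟨i, hi⟩ : ∃ i, N = j + 2 + i := ⟨N - (j + 2), by omega⟩
    have h3 := wt_e (r := r) N (j + 1) (i + 2) (by omega)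
    have hc := c_pos hr i
    have h4 := (h2.pow r).add_low DegLe.one (by
      rw [map_nsmul, h3, nsmul_eq_mul]
      have : (2 : ℤ) ≤ r := by exact_mod_cast hr
      nlinarith)
    have h5 : yy r (j + 1) * yy r (j + 2 + 1) = yy r (j + 1 + 1) ^ r + 1 := by
      rw [mul_comm]; exact yy_rel (by omega) (j + 1)
    rw [← h5] at h4
    convert h1.div h4 using 1
    simp [c]
    ring

lemma yy_facts {r : ℕ} (hr : 2 ≤ r) (N : ℕ) (hN : 1 ≤ N) :
    Top (wt (c r (N + 1)) (c r N)) (yy r (N + 1)) (-c r N, c r (N + 1)) ∧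
    DegLe (wt (c r (N + 1)) (c r N)) (yy r (N + 2)) (-1) ∧
    Top (wt (c r (N + 1)) (c r N)) (yy r (N + 3)) (c r N, -c r (N + 1)) := by
  obtain ⟨M, rfl⟩ : ∃ M, N = M + 1 := ⟨N - 1, by omega⟩
  have h1 := top_yy hr (M + 1) (M + 1) le_rfl
  have h0 := top_yy hr (M + 1) M (by omega)
  have w1 := wt_e (r := r) (M + 1) (M + 1) 1 (by omega)
  have w0 := wt_e (r := r) (M + 1) M 2 (by omega)
  have hr1 : 1 ≤ r := by omega
  have e1 : yy r (M + 1) * yy r (M + 1 + 2) = yy r (M + 1 + 1) ^ r + 1 := by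
    rw [mul_comm]; exact yy_rel hr1 (M + 1)
  have e2 : yy r (M + 1 + 1) * yy r (M + 1 + 3) = yy r (M + 1 + 2) ^ r + 1 := by
    rw [mul_comm]; exact yy_rel hr1 (M + 2)
  have d1 : DegLe (wt (c r (M + 1 + 1)) (c r (M + 1))) (yy r (M + 1 + 2)) (-1) := by
    have : DegLe (wt (c r (M + 1 + 1)) (c r (M + 1))) (yy r (M + 1 + 1) ^ r + 1) 0 := by
      refine DegLe.add ?_ DegLe.one
      have := (h1.pow r).1
      rw [map_nsmul, w1] at this
      simpa [c] using this
    rw [← e1] at this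
    have := h0.degLe_right this
    rw [w0] at this
    simpa [c] using this
  refine ⟨h1, d1, ?_⟩
  have d2 : Top (wt (c r (M + 1 + 1)) (c r (M + 1))) (yy r (M + 1 + 2) ^ r + 1) 0 := by
    rw [add_comm (yy r (M + 1 + 2) ^ r)]
    refine Top.one.add_low (d1.pow r) ?_
    simp; omega
  rw [← e2] at d2
  convert h1.div d2 using 1
  simp

end

noncomputable section
open LaurentPolynomial

/-- Evaluation at a pair of units. -/
def ev {A : Type*} [CommRing A] (α β : Aˣ) : R0 →+* A :=
  (AddMonoidAlgebra.lift ℤ A (ℤ × ℤ)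
    { toFun := fun p => ((α ^ (Multiplicative.toAdd p).1 * β ^ (Multiplicative.toAdd p).2 : Aˣ) : A)
      map_one' := by simp
      map_mul' := fun p q => by
        simp only [toAdd_mul, Prod.fst_add, Prod.snd_add, zpow_add, Units.val_mul]
        ring } : R0 →ₐ[ℤ] A).toRingHom

lemma ev_single {A : Type*} [CommRing A] (α β : Aˣ) (p : ℤ × ℤ) (a : ℤ) :
    ev α β (AddMonoidAlgebra.single p a) = a * ((α ^ p.1 * β ^ p.2 : Aˣ) : A) := by
  simp [ev]

/-- Uniqueness of recurrences. -/
lemma rec_unique {A : Type*} [CommRing A] [IsDomain A] {r : ℕ} (a b : ℕ → A)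
    (ha : ∀ n, a (n + 2) * a n = a (n + 1) ^ r + 1) (hb : ∀ n, b (n + 2) * b n = b (n + 1) ^ r + 1)
    (hne : ∀ n, a n ≠ 0) (h0 : a 0 = b 0) (h1 : a 1 = b 1) : ∀ n, a n = b n
  | 0 => h0
  | 1 => h1
  | n + 2 => by
    have e0 := rec_unique a b ha hb hne h0 h1 n
    have e1 := rec_unique a b ha hb hne h0 h1 (n + 1)
    have h := ha n
    rw [e1, ← hb n, ← e0] at h
    exact mul_right_cancel₀ (hne n) h

lemma yy_ne {r : ℕ} (hr : 1 ≤ r) (n : ℕ) : yy r n ≠ 0 := by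
  set e := ev (A := ℚ) 1 1
  have hrel : ∀ n, e (yy r (n + 2)) * e (yy r n) = e (yy r (n + 1)) ^ r + 1 := by
    intro n; rw [← map_mul, yy_rel hr]; simp
  have key : ∀ n, 0 < e (yy r n) ∧ 0 < e (yy r (n + 1)) := by
    intro n
    induction n with
    | zero => simp [yy, e, ev_single]
    | succ n ih =>
      refine ⟨ih.2, ?_⟩
      have h := hrel n
      have h2 : 0 < e (yy r (n + 2)) * e (yy r n) := by
        rw [h]; have := ih.2; positivity
      exact pos_of_mul_pos_left h2 ih.1.le
  intro h
  have := (key n).1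
  rw [h] at this; simp at this

/-- Slices. -/
def sl (π1 π2 : ℤ × ℤ → ℤ) (s : ℤ) (f : R0) : Lam :=
  f.coeff.sum fun p a => if π1 p = s then AddMonoidAlgebra.single (π2 p) a else 0

lemma sl_zero (π1 π2 : ℤ × ℤ → ℤ) (s : ℤ) : sl π1 π2 s 0 = 0 := by simp [sl]

lemma sl_add (π1 π2 : ℤ × ℤ → ℤ) (s : ℤ) (f g : R0) :
    sl π1 π2 s (f + g) = sl π1 π2 s f + sl π1 π2 s g := by
  unfold sl
  rw [AddMonoidAlgebra.coeff_add]
  refine Finsupp.sum_add_index' ?_ ?_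
  · intro p; simp
  · intro p a b; split_ifs <;> simp

lemma sl_single (π1 π2 : ℤ × ℤ → ℤ) (s : ℤ) (p : ℤ × ℤ) (a : ℤ) :
    sl π1 π2 s (AddMonoidAlgebra.single p a) =
      if π1 p = s then AddMonoidAlgebra.single (π2 p) a else 0 := by
  unfold sl
  rw [AddMonoidAlgebra.coeff_single, Finsupp.sum_single_index]
  simp

lemma sl_coeff_row (s t : ℤ) (f : R0) : (sl Prod.fst Prod.snd s f).coeff t = f.coeff (s, t) := by
  induction f using AddMonoidAlgebra.induction_linear with
  | zero => simp [sl_zero]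
  | add f g hf hg => rw [sl_add, coeff_addL, hf, hg, coeff_add0]
  | single p a =>
    rw [sl_single, coeff_single0]
    split_ifs with h1 h2 h2
    · rw [AddMonoidAlgebra.coeff_single, Finsupp.single_apply, if_pos (by rw [h2])]
    · rw [AddMonoidAlgebra.coeff_single, Finsupp.single_apply, if_neg]
      intro h; exact h2 (Prod.ext h1 h)
    · exact absurd (by rw [h2]) h1
    · simp

lemma sl_coeff_col (s t : ℤ) (f : R0) : (sl Prod.snd Prod.fst s f).coeff t = f.coeff (t, s) := by
  induction f using AddMonoidAlgebra.induction_linear with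
  | zero => simp [sl_zero]
  | add f g hf hg => rw [sl_add, coeff_addL, hf, hg, coeff_add0]
  | single p a =>
    rw [sl_single, coeff_single0]
    split_ifs with h1 h2 h2
    · rw [AddMonoidAlgebra.coeff_single, Finsupp.single_apply, if_pos (by rw [h2])]
    · rw [AddMonoidAlgebra.coeff_single, Finsupp.single_apply, if_neg]
      intro h; exact h2 (Prod.ext h h1)
    · exact absurd (by rw [h2]) h1
    · simp

/-- Fractions. -/
abbrev Fr := FractionRing Lam
/-- Laurent polynomials over fractions. -/
abbrev Om := LaurentPolynomial Fr

instance : IsDomain Om := inferInstance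

/-- The embedding. -/
def io : Lam →+* Fr := algebraMap Lam Fr

lemma io_inj : Function.Injective io := IsFractionRing.injective Lam Fr

lemma coeff_CT (x : Fr) (n m : ℤ) : (C x * T n : Om).coeff m = if n = m then x else 0 := by
  rw [← single_eq_C_mul_T, AddMonoidAlgebra.coeff_single, Finsupp.single_apply]

lemma slice_key (π1 π2 : ℤ × ℤ → ℤ) (θ : R0 →+* Om) (w : Frˣ) (ε : ℤ) (hε : ε ≠ 0)
    (h : ∀ p a, θ (AddMonoidAlgebra.single p a) =
      C (io (AddMonoidAlgebra.single (π2 p) a) * (w ^ π1 p : Frˣ)) * T (ε * π1 p)) (f : R0) (s : ℤ) :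
    (θ f).coeff (ε * s) = io (sl π1 π2 s f) * (w ^ s : Frˣ) := by
  induction f using AddMonoidAlgebra.induction_linear with
  | zero => simp [sl_zero]
  | add f g hf hg =>
    rw [map_add, sl_add, map_add, add_mul, ← hf, ← hg]
    simp only [AddMonoidAlgebra.coeff_add, Finsupp.coe_add, Pi.add_apply]
  | single p a =>
    rw [h, coeff_CT, sl_single]
    by_cases hp : π1 p = s
    · simp [hp]
    · rw [if_neg, if_neg hp]
      · simp
      · intro h; exact hp (mul_left_cancel₀ hε h)

/-- The variable of `Lam`, as a unit of `Fr`. -/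
def yU : Frˣ where
  val := io (T 1)
  inv := io (T (-1))
  val_inv := by rw [← map_mul, ← T_add]; simp
  inv_val := by rw [← map_mul, ← T_add]; simp

lemma zpow_nat_or {A : Type*} [CommRing A] (U : Aˣ) (g : ℤ → A) (h1 : (U : A) = g 1)
    (h2 : ((U⁻¹ : Aˣ) : A) = g (-1)) (h3 : ∀ (m : ℤ) (k : ℕ), g m ^ k = g (k * m)) (n : ℤ) :
    ((U ^ n : Aˣ) : A) = g n := by
  obtain ⟨k, rfl | rfl⟩ := n.eq_nat_or_neg
  · rw [zpow_natCast, Units.val_pow_eq_pow_val, h1, h3, mul_one]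
  · rw [← inv_zpow', zpow_natCast, Units.val_pow_eq_pow_val, h2, h3]
    congr 1; ring

lemma yU_zpow (n : ℤ) : ((yU ^ n : Frˣ) : Fr) = io (T n) :=
  zpow_nat_or yU (fun n => io (T n)) rfl rfl (fun m k => by rw [← map_pow, T_pow]) n

lemma onepy_ne {r : ℕ} (_hr : 1 ≤ r) : (1 + io (T 1) ^ r : Fr) ≠ 0 := by
  have : (1 + io (T 1) ^ r : Fr) = io (1 + T r) := by rw [map_add, map_one, ← map_pow, T_pow, mul_one]
  rw [this]
  intro h
  have h2 : (1 + T r : Lam) = 0 := io_inj (by rw [h, map_zero])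
  have h3 : (1 + T r : Lam).coeff 0 = 0 := by rw [h2]; simp
  rw [coeff_addL, ← T_zero, coeff_T, coeff_T] at h3
  simp only [if_true] at h3
  split_ifs at h3 <;> norm_num at h3

/-- `1 + y ^ r` as a unit. -/
def wU (r : ℕ) (hr : 1 ≤ r) : Frˣ := Units.mk0 _ (onepy_ne hr)

/-- Constants as units. -/
def CU (w : Frˣ) : Omˣ := Units.map (C : Fr →+* Om).toMonoidHom w

/-- Monomials as units. -/
def TU (n : ℤ) : Omˣ where
  val := T n
  inv := T (-n)
  val_inv := by rw [← T_add]; simp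
  inv_val := by rw [← T_add]; simp

lemma TU_zpow (n : ℤ) : ((TU 1 ^ n : Omˣ) : Om) = T n :=
  zpow_nat_or (TU 1) (fun n => T n) rfl rfl (fun m k => by rw [T_pow]) n

lemma TU'_zpow (n : ℤ) : ((TU (-1) ^ n : Omˣ) : Om) = T (-1 * n) :=
  zpow_nat_or (TU (-1)) (fun n => T (-1 * n)) rfl (by change T _ = T _; congr 1)
    (fun m k => by rw [T_pow]; congr 1; ring) n

lemma CU_zpow (w : Frˣ) (n : ℤ) : ((CU w ^ n : Omˣ) : Om) = C ((w ^ n : Frˣ) : Fr) := by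
  unfold CU
  rw [← map_zpow]; rfl

lemma CT_zpow (w : Frˣ) (n : ℤ) : (((CU w * TU (-1)) ^ n : Omˣ) : Om) =
    C ((w ^ n : Frˣ) : Fr) * T (-1 * n) := by
  have h := mul_zpow (CU w) (TU (-1)) n
  exact (congrArg (fun z : Omˣ => (z : Om)) h).trans (by
    rw [← CU_zpow, ← TU'_zpow]; rfl)

lemma int_io (a n : ℤ) (w : Fr) : ((a : Om) * C (io (T n) * w)) =
    C (io (AddMonoidAlgebra.single n a) * w) := by
  have h : (AddMonoidAlgebra.single n a : Lam) = (a : Lam) * T n := by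
    rw [single_eq_C_mul_T]; simp
  rw [h]; simp [mul_assoc]

lemma th1 (p : ℤ × ℤ) (a : ℤ) : ev (TU 1) (CU yU) (AddMonoidAlgebra.single p a) =
    C (io (AddMonoidAlgebra.single p.2 a) * ((1 : Frˣ) ^ p.1 : Frˣ)) * T (1 * p.1) := by
  rw [ev_single, ← int_io, Units.val_mul, TU_zpow, CU_zpow, yU_zpow]
  simp; ring

lemma th1' (p : ℤ × ℤ) (a : ℤ) : ev (CU yU) (TU 1) (AddMonoidAlgebra.single p a) =
    C (io (AddMonoidAlgebra.single p.1 a) * ((1 : Frˣ) ^ p.2 : Frˣ)) * T (1 * p.2) := by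
  rw [ev_single, ← int_io, Units.val_mul, TU_zpow, CU_zpow, yU_zpow]
  simp; ring

lemma th2 (w : Frˣ) (p : ℤ × ℤ) (a : ℤ) :
    ev (CU yU) (CU w * TU (-1)) (AddMonoidAlgebra.single p a) =
    C (io (AddMonoidAlgebra.single p.1 a) * (w ^ p.2 : Frˣ)) * T (-1 * p.2) := by
  rw [ev_single, ← int_io, Units.val_mul, CT_zpow, CU_zpow,
    yU_zpow, map_mul]
  ring

lemma th2' (w : Frˣ) (p : ℤ × ℤ) (a : ℤ) :
    ev (CU w * TU (-1)) (CU yU) (AddMonoidAlgebra.single p a) =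
    C (io (AddMonoidAlgebra.single p.2 a) * (w ^ p.1 : Frˣ)) * T (-1 * p.1) := by
  rw [ev_single, ← int_io, Units.val_mul, CT_zpow, CU_zpow,
    yU_zpow, map_mul]
  ring

lemma ev_ne (θ : R0 →+* Om) (π1 π2 : ℤ × ℤ → ℤ) 
    (hπ : ∀ f, (∀ s, sl π1 π2 s f = 0) → f = 0)
    (h : ∀ p a, θ (AddMonoidAlgebra.single p a) =
      C (io (AddMonoidAlgebra.single (π2 p) a) * ((1 : Frˣ) ^ π1 p : Frˣ)) * T (1 * π1 p))
    (f : R0) (hf : f ≠ 0) : θ f ≠ 0 := by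
  intro h0
  apply hf
  apply hπ
  intro s
  have := slice_key π1 π2 θ 1 1 one_ne_zero h f s
  rw [h0] at this
  simp at this
  exact io_inj (by rw [← this, map_zero])

lemma wU_val (r : ℕ) (hr : 1 ≤ r) (k : ℕ) : ((wU r hr ^ k : Frˣ) : Fr) = io ((1 + T r) ^ k) := by
  rw [Units.val_pow_eq_pow_val, map_pow]
  congr 1
  change (1 + io (T 1) ^ r : Fr) = _
  rw [map_add, map_one, ← map_pow, T_pow, mul_one]

lemma rel_of_eq {r : ℕ} (hr : 1 ≤ r) {π1 π2 : ℤ × ℤ → ℤ} {θ θ' : R0 →+* Om} {f g : R0}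
    (h : ∀ p a, θ (AddMonoidAlgebra.single p a) =
      C (io (AddMonoidAlgebra.single (π2 p) a) * ((1 : Frˣ) ^ π1 p : Frˣ)) * T (1 * π1 p))
    (h' : ∀ p a, θ' (AddMonoidAlgebra.single p a) =
      C (io (AddMonoidAlgebra.single (π1 p) a) * (wU r hr ^ π2 p : Frˣ)) * T (-1 * π2 p))
    (hfg : θ f = θ' g) (k : ℕ) : sl π1 π2 (-k) f = (1 + T r) ^ k * sl π2 π1 k g := by
  have e1 := slice_key π1 π2 θ 1 1 one_ne_zero h f (-k)
  have e2 := slice_key π2 π1 θ' (wU r hr) (-1) (by norm_num) h' g k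
  rw [hfg] at e1
  have e3 : (1 : ℤ) * (-k) = -1 * k := by ring
  rw [e3, e2, zpow_natCast, wU_val] at e1
  simp only [one_zpow, Units.val_one, mul_one] at e1
  apply io_inj
  rw [← e1, map_mul, mul_comm]

lemma wU_one (r : ℕ) (hr : 1 ≤ r) : (C ((wU r hr : Frˣ) : Fr) : Om) = C (io (T 1)) ^ r + 1 := by
  change (C (1 + io (T 1) ^ r : Fr) : Om) = _
  rw [map_add, map_one, map_pow, add_comm]

lemma ev_rel {r : ℕ} (hr : 1 ≤ r) (θ : R0 →+* Om) (n : ℕ) :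
    θ (yy r (n + 2)) * θ (yy r n) = θ (yy r (n + 1)) ^ r + 1 := by
  rw [← map_mul, yy_rel hr]; simp

lemma T1_mul : (T 1 * T (-1) : Om) = 1 := by rw [← T_add]; simp

lemma T_ne (n : ℤ) : (T n : Om) ≠ 0 := by
  intro h
  have : (T n * T (-n) : Om) = 1 := by rw [← T_add]; simp
  rw [h, zero_mul] at this
  exact zero_ne_one this

lemma CT_ne (w : Frˣ) : (C (w : Fr) * T (-1) : Om) ≠ 0 := by
  refine mul_ne_zero ?_ (T_ne _)
  intro h
  have : (C (w : Fr) * C ((w⁻¹ : Frˣ) : Fr) : Om) = 1 := by rw [← map_mul]; simp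
  rw [h, zero_mul] at this
  exact zero_ne_one this

lemma row_rel {r : ℕ} (hr : 1 ≤ r) (n k : ℕ) :
    sl Prod.fst Prod.snd (-k) (yy r (n + 1)) =
      (1 + T r) ^ k * sl Prod.snd Prod.fst k (yy r n) := by
  refine rel_of_eq hr th1 (th2 (wU r hr)) ?_ k
  have hne : ∀ n, ev (TU 1) (CU yU) (yy r n) ≠ 0 := by
    intro n
    refine ev_ne _ Prod.fst Prod.snd (fun f hf => ?_) th1 _ (yy_ne hr n)
    apply AddMonoidAlgebra.ext
    apply Finsupp.ext
    rintro ⟨s, t⟩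
    rw [← sl_coeff_row, hf]; simp
  have a1 : ev (TU 1) (CU yU) (yy r 1) = T 1 := by rw [yy, th1]; simp [← AddMonoidAlgebra.one_def]
  have a2 : ev (TU 1) (CU yU) (yy r 2) = C (io (T 1)) := by rw [yy, th1]; simp
  have b1 : ev (CU yU) (CU (wU r hr) * TU (-1)) (yy r 1) = C (io (T 1)) := by
    rw [yy, th2]; simp
  have b2 : ev (CU yU) (CU (wU r hr) * TU (-1)) (yy r 2) = C ((wU r hr : Frˣ) : Fr) * T (-1) := by
    rw [yy, th2]; simp [← AddMonoidAlgebra.one_def]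
  refine rec_unique (r := r) (fun n => ev (TU 1) (CU yU) (yy r (n + 1)))
    (fun n => ev (CU yU) (CU (wU r hr) * TU (-1)) (yy r n)) (fun n => ev_rel hr _ (n + 1))
    (fun n => ev_rel hr _ n) (fun n => hne (n + 1)) ?_ ?_ n
  · have h := ev_rel hr (ev (CU yU) (CU (wU r hr) * TU (-1))) 0
    simp only [zero_add] at h ⊢
    rw [b1, b2, ← wU_one r hr] at h
    rw [a1]
    apply mul_left_cancel₀ (CT_ne (wU r hr))
    rw [h]
    linear_combination (C ((wU r hr : Frˣ) : Fr)) * T1_mul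
  · simp only [Nat.reduceAdd]
    rw [a2, b1]

lemma col_rel {r : ℕ} (hr : 1 ≤ r) (n k : ℕ) :
    sl Prod.snd Prod.fst (-k) (yy r n) =
      (1 + T r) ^ k * sl Prod.fst Prod.snd k (yy r (n + 1)) := by
  refine rel_of_eq hr th1' (th2' (wU r hr)) ?_ k
  have hne : ∀ n, ev (CU yU) (TU 1) (yy r n) ≠ 0 := by
    intro n
    refine ev_ne _ Prod.snd Prod.fst (fun f hf => ?_) th1' _ (yy_ne hr n)
    apply AddMonoidAlgebra.ext
    apply Finsupp.ext
    rintro ⟨s, t⟩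
    rw [← sl_coeff_col, hf]; simp
  have a1 : ev (CU yU) (TU 1) (yy r 1) = C (io (T 1)) := by rw [yy, th1']; simp
  have a2 : ev (CU yU) (TU 1) (yy r 2) = T 1 := by rw [yy, th1']; simp [← AddMonoidAlgebra.one_def]
  have b1 : ev (CU (wU r hr) * TU (-1)) (CU yU) (yy r 1) = C ((wU r hr : Frˣ) : Fr) * T (-1) := by
    rw [yy, th2']; simp [← AddMonoidAlgebra.one_def]
  have b2 : ev (CU (wU r hr) * TU (-1)) (CU yU) (yy r 2) = C (io (T 1)) := by
    rw [yy, th2']; simp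
  refine rec_unique (r := r) (fun n => ev (CU yU) (TU 1) (yy r n))
    (fun n => ev (CU (wU r hr) * TU (-1)) (CU yU) (yy r (n + 1))) (fun n => ev_rel hr _ n)
    (fun n => ev_rel hr _ (n + 1)) hne ?_ ?_ n
  · have h := ev_rel hr (ev (CU yU) (TU 1)) 0
    simp only [zero_add] at h ⊢
    rw [a1, a2, ← wU_one r hr] at h
    rw [b1]
    apply mul_left_cancel₀ (T_ne 1)
    rw [h]
    linear_combination (-C ((wU r hr : Frˣ) : Fr)) * T1_mul
  · simp only [Nat.reduceAdd]
    rw [a1, b2]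

/-- Cluster variables satisfy the greedy conditions. -/
lemma yy_greedy {r : ℕ} (hr : 2 ≤ r) (N : ℕ) (hN : 1 ≤ N) :
    Greedy r (c r (N + 1)) (c r N) (fun s t => (yy r (N + 2)).coeff (s, t)) := by
  obtain ⟨f1, f2, f3⟩ := yy_facts hr N hN
  obtain ⟨M, rfl⟩ : ∃ M, N = M + 1 := ⟨N - 1, by omega⟩
  have hc := c_pos hr M
  have hr1 : 1 ≤ r := by omega
  have topc : ∀ {f : R0} {e : ℤ × ℤ} {φ : ℤ × ℤ →+ ℤ}, Top φ f e → φ e = 0 → ∀ p, 0 ≤ φ p →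
      f.coeff p = if p = e then 1 else 0 := by
    intro f e φ h he p hp
    rcases hp.lt_or_eq with h1 | h1
    · rw [h.1.coeff (by omega), if_neg]
      rintro rfl; omega
    · exact h.2 p (by omega)
  refine ⟨?_, ?_, ?_⟩
  · intro k
    refine ⟨sl Prod.snd Prod.fst k (yy r (M + 1 + 1)), fun t => ?_, fun t ht => ?_⟩
    · simp only [← row_rel hr1, sl_coeff_row]
    · rw [sl_coeff_col, topc f1 (by simp [wt_apply]; ring) _ (by simp only [wt_apply]; linarith)]
      simp only [Prod.mk.injEq, and_comm]
  · intro k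
    refine ⟨sl Prod.fst Prod.snd k (yy r (M + 1 + 3)), fun t => ?_, fun t ht => ?_⟩
    · simp only [← col_rel hr1 (M + 1 + 2), sl_coeff_col]
    · rw [sl_coeff_row, topc f3 (by simp [wt_apply]; ring) _ (by simp only [wt_apply]; linarith)]
      simp only [Prod.mk.injEq]
  · intro s t hs ht
    refine f2.coeff ?_
    simp only [wt_apply]
    have := mul_pos (show 0 < c r (M + 1 + 1) by linarith [hc.1, hc.2]) hs
    have := mul_nonneg hc.1 ht.le
    linarith

lemma yy_nonneg {r : ℕ} (hr : 2 ≤ r) : ∀ n, 1 ≤ n → ∀ p, 0 ≤ (yy r n).coeff p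
  | 0, h => by omega
  | 1, _ => by intro p; rw [yy, coeff_single0]; split_ifs <;> simp
  | 2, _ => by intro p; rw [yy, coeff_single0]; split_ifs <;> simp
  | 3, _ => by
    intro p
    rw [yy, AddMonoidAlgebra.single_pow, add_mul, one_mul, AddMonoidAlgebra.single_mul_single,
      coeff_add0, coeff_single0, coeff_single0]
    simp only [one_pow, mul_one]
    split_ifs <;> simp
  | n + 4, _ => by
    have h := yy_greedy hr (n + 2) (by omega)
    have h1 := c_pos hr n
    have h2 := c_pos hr (n + 1)
    have e1 : c r (n + 2 + 1) = ((c r (n + 2 + 1)).toNat : ℤ) := by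
      rw [Int.toNat_of_nonneg]; exact le_trans h2.1 h2.2.le
    have e2 : c r (n + 2) = ((c r (n + 2)).toNat : ℤ) := by
      rw [Int.toNat_of_nonneg]; exact le_trans h1.1 h1.2.le
    have p1 : 0 < c r (n + 2) := by linarith [h1.1, h1.2]
    have p2 : 0 < c r (n + 2 + 1) := lt_of_le_of_lt h2.1 h2.2
    rw [e1, e2] at h
    exact greedy_expansion (by omega) (by omega) (by omega) h

end

noncomputable section

lemma ev_eq {A : Type*} [CommRing A] (α β : Aˣ) (f : R0) :
    ev α β f = ∑ p ∈ f.coeff.support, (f.coeff p : A) * ((α ^ p.1 * β ^ p.2 : Aˣ) : A) := by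
  simp [ev, AddMonoidAlgebra.lift_apply, Finsupp.sum]

lemma main_gen {F : Type*} [Field F] {r : ℕ} (hr : 2 ≤ r) (X : ℤ → F) (hne : ∀ m, X m ≠ 0)
    (hrec : ∀ m : ℤ, X (m + 1) * X (m - 1) = X m ^ r + 1) (n : ℕ) (hn : 1 ≤ n) :
    ∃ (s : Finset (ℤ × ℤ)) (a : ℤ × ℤ → ℕ),
      X n = ∑ p ∈ s, (a p : F) * X 1 ^ p.1 * X 2 ^ p.2 := by
  set e := ev (Units.mk0 (X 1) (hne 1)) (Units.mk0 (X 2) (hne 2)) with he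
  have hb : ∀ n, e (yy r (n + 2)) * e (yy r n) = e (yy r (n + 1)) ^ r + 1 := by
    intro n; rw [← map_mul, yy_rel (by omega)]; simp
  have ha : ∀ n : ℕ, X ((n + 2 : ℕ) : ℤ) * X (n : ℤ) = X ((n + 1 : ℕ) : ℤ) ^ r + 1 := by
    intro n
    have := hrec (n + 1)
    push_cast
    convert this using 3 <;> ring
  have e1 : e (yy r 1) = X 1 := by rw [yy, he, ev_single]; simp
  have e2 : e (yy r 2) = X 2 := by rw [yy, he, ev_single]; simp
  have key := rec_unique (r := r) (fun n : ℕ => X n) (fun n => e (yy r n)) ha hb (fun n => hne _) (by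
    have h1 := ha 0
    have h2 := hb 0
    simp only [zero_add] at h1 h2
    rw [e1, e2] at h2
    have : X 2 * X 0 = X 2 * e (yy r 0) := by
      rw [h2]; exact_mod_cast h1
    exact_mod_cast mul_left_cancel₀ (hne 2) this) (by simp [e1]) n
  refine ⟨(yy r n).coeff.support, fun p => ((yy r n).coeff p).toNat, ?_⟩
  rw [key, he, ev_eq]
  refine Finset.sum_congr rfl fun p _ => ?_
  have h0 := yy_nonneg hr n hn p
  have h1 : ((((yy r n).coeff p).toNat : ℕ) : F) = (((yy r n).coeff p : ℤ) : F) := by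
    conv_rhs => rw [← Int.toNat_of_nonneg h0]
    exact (Int.cast_natCast _).symm
  rw [h1]
  simp [mul_assoc]

/-- Quotients of polynomials positive at `(1,1)`. -/
def PosK (z : K) : Prop := ∃ p q : MvPolynomial (Fin 2) ℚ,
  0 < MvPolynomial.eval (fun _ => (1 : ℚ)) p ∧ 0 < MvPolynomial.eval (fun _ => (1 : ℚ)) q ∧
  z * algebraMap _ K q = algebraMap _ K p

lemma alg_ne {q : MvPolynomial (Fin 2) ℚ} (h : 0 < MvPolynomial.eval (fun _ => (1 : ℚ)) q) :
    algebraMap _ K q ≠ 0 := by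
  intro h0
  have : q = 0 := IsFractionRing.injective (MvPolynomial (Fin 2) ℚ) K (by rw [h0, map_zero])
  rw [this] at h; simp at h

lemma PosK.ne {z : K} (h : PosK z) : z ≠ 0 := by
  obtain ⟨p, q, hp, hq, h⟩ := h
  rintro rfl
  rw [zero_mul] at h
  exact alg_ne hp h.symm

lemma PosK.mul {z w : K} (h : PosK z) (h' : PosK w) : PosK (z * w) := by
  obtain ⟨p, q, hp, hq, h⟩ := h
  obtain ⟨p', q', hp', hq', h'⟩ := h'
  refine ⟨p * p', q * q', by rw [map_mul]; positivity, by rw [map_mul]; positivity, ?_⟩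
  rw [map_mul, map_mul, ← h, ← h']; ring

lemma PosK.one : PosK 1 := ⟨1, 1, by simp, by simp, by simp⟩

lemma PosK.pow {z : K} (h : PosK z) (k : ℕ) : PosK (z ^ k) := by
  induction k with
  | zero => simpa using PosK.one
  | succ k ih => rw [pow_succ]; exact ih.mul h

lemma PosK.add {z w : K} (h : PosK z) (h' : PosK w) : PosK (z + w) := by
  obtain ⟨p, q, hp, hq, h⟩ := h
  obtain ⟨p', q', hp', hq', h'⟩ := h'
  refine ⟨p * q' + p' * q, q * q', by rw [map_add, map_mul, map_mul]; positivity,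
    by rw [map_mul]; positivity, ?_⟩
  rw [map_mul, map_add, map_mul, map_mul, ← h, ← h']; ring

lemma PosK.of_mul {z w : K} (h : PosK (z * w)) (h' : PosK w) : PosK z := by
  have hw := h'.ne
  obtain ⟨p, q, hp, hq, h⟩ := h
  obtain ⟨p', q', hp', hq', h'⟩ := h'
  refine ⟨p * q', q * p', by rw [map_mul]; positivity, by rw [map_mul]; positivity, ?_⟩
  rw [map_mul, map_mul, ← h, ← h']; ring

lemma PosK.X (i : Fin 2) : PosK (algebraMap (MvPolynomial (Fin 2) ℚ) K (MvPolynomial.X i)) :=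
  ⟨MvPolynomial.X i, 1, by simp, by simp, by simp⟩

lemma X_pos {r : ℕ} (X : ℤ → K) (hX1 : X 1 = x₁) (hX2 : X 2 = x₂)
    (hrec : ∀ m : ℤ, X (m + 1) * X (m - 1) = X m ^ r + 1) (m : ℤ) : PosK (X m) ∧ PosK (X (m + 1)) := by
  have h1 : PosK (X 1) := by rw [hX1]; exact PosK.X 0
  have h2 : PosK (X 2) := by rw [hX2]; exact PosK.X 1
  have step : ∀ m, PosK (X m) → (PosK (X (m + 1)) ↔ PosK (X (m - 1))) := by
    intro m hm
    have h := (hm.pow r).add PosK.one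
    rw [← hrec] at h
    exact ⟨fun h' => (by rw [mul_comm] at h; exact h.of_mul h'), fun h' => h.of_mul h'⟩
  induction m using Int.induction_on with
  | zero =>
    refine ⟨?_, by simpa using h1⟩
    have := (step 1 h1).1 (by simpa using h2)
    simpa using this
  | succ i ih =>
    refine ⟨ih.2, (step _ ih.2).2 ?_⟩
    rw [add_sub_cancel_right]; exact ih.1
  | pred i ih =>
    exact ⟨(step _ ih.1).1 ih.2, by rw [sub_add_cancel]; exact ih.1⟩

end

theorem positivity_laurent (r : ℕ) (hr : 2 ≤ r) (X : ℤ → K)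
    (hX1 : X 1 = x₁) (hX2 : X 2 = x₂)
    (hrec : ∀ m : ℤ, X (m + 1) * X (m - 1) = X m ^ r + 1)
    (n : ℤ) :
    ∃ (s : Finset (ℤ × ℤ)) (a : ℤ × ℤ → ℕ),
      X n = ∑ p ∈ s, (a p : K) * x₁ ^ p.1 * x₂ ^ p.2 := by
  have hne : ∀ m, X m ≠ 0 := fun m => (X_pos X hX1 hX2 hrec m).1.ne
  rcases le_or_gt 1 n with h | h
  · obtain ⟨k, rfl⟩ : ∃ k : ℕ, n = k := ⟨n.toNat, by omega⟩
    have := main_gen hr X hne hrec k (by omega)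
    rwa [hX1, hX2] at this
  · obtain ⟨k, hk⟩ : ∃ k : ℕ, 3 - n = k := ⟨(3 - n).toNat, by omega⟩
    obtain ⟨s, a, hs⟩ := main_gen hr (fun m => X (3 - m)) (fun m => hne _) (by
      intro m
      have := hrec (3 - m)
      rw [mul_comm] at this
      convert this using 3 <;> ring) k (by omega)
    have e1 : (3 : ℤ) - 1 = 2 := by norm_num
    have e2 : (3 : ℤ) - 2 = 1 := by norm_num
    have e3 : 3 - (k : ℤ) = n := by omega
    simp only [e1, e2, e3, hX1, hX2] at hs
    refine ⟨s.map (Equiv.prodComm ℤ ℤ).toEmbedding, fun p => a p.swap, ?_⟩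
    rw [hs, Finset.sum_map]
    refine Finset.sum_congr rfl fun p _ => ?_
    simp
    ring

end CF
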